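/- arXiv:1211.4632 — 11 statements merged into one kernel-verified Lean document; each statement's English description precedes it below -/
import Mathlib

section
/- Let n₁, n₂ be positive integers and let p₁ ≤ p₂ be rational numbers with n₁p₁ ∈ ℤ and n₂p₂ ∈ ℤ. Then there exists ε₀ > 0 such that for every ε with 0 < ε < ε₀, the number of pairs (a,b) ∈ ℤ × ℤ for which the perturbed lattice point (a+ε, b+ε) lies in the triangle T(p₁,p₂) is exactly λ(p₁,p₂). In particular, λ(p₁,p₂) is a nonnegative integer. -/
/-- `ψ(x) = x(x-1)/2`. -/
noncomputable def psi (x : ℝ) : ℝ := x * (x - 1) / 2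

/-- The piecewise-linear function `φ(x) = ψ(⌊x⌋) + ⌊x⌋·(x − ⌊x⌋)`. -/
noncomputable def phi (x : ℝ) : ℝ := psi (⌊x⌋ : ℝ) + (⌊x⌋ : ℝ) * (x - (⌊x⌋ : ℝ))

/-- An expansion of `phi` as an affine function plus hinge functions at the integers of
`(L, L + k]`, truncated at the right end of this range. -/
lemma psi_add_sum_hinge (L : ℤ) (x : ℝ) (hL : L ≤ ⌊x⌋) (k : ℕ) :
    psi (L : ℝ) + (L : ℝ) * (x - L) + ∑ a ∈ Finset.Ioc L (L + k), max (x - a) 0 =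
      psi ((min (L + k) ⌊x⌋ : ℤ) : ℝ) +
        ((min (L + k) ⌊x⌋ : ℤ) : ℝ) * (x - ((min (L + k) ⌊x⌋ : ℤ) : ℝ)) := by
  induction k with
  | zero => simp [hL]
  | succ k ih =>
    have hIoc : Finset.Ioc L (L + ((k + 1 : ℕ) : ℤ)) =
        insert (L + k + 1) (Finset.Ioc L (L + k)) := by
      ext a
      simp only [Finset.mem_Ioc, Finset.mem_insert]
      omega
    rw [hIoc, Finset.sum_insert (by simp), add_left_comm, ih]
    rcases le_or_gt (L + k + 1) ⌊x⌋ with h | h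
    · have hx : ((L + k + 1 : ℤ) : ℝ) ≤ x := Int.le_floor.mp h
      rw [min_eq_left (by omega), min_eq_left (by omega), max_eq_left (by linarith)]
      push_cast
      unfold psi
      ring
    · have hx : x < ((L + k + 1 : ℤ) : ℝ) := Int.floor_lt.mp h
      rw [min_eq_right (by omega), min_eq_right (by omega), max_eq_right (by linarith), zero_add]

lemma phi_eq_affine_add_sum_hinge {L K : ℤ} {x : ℝ} (hL : L ≤ ⌊x⌋) (hK : ⌊x⌋ ≤ K) :
    phi x = psi (L : ℝ) + (L : ℝ) * (x - L) + ∑ a ∈ Finset.Ioc L K, max (x - a) 0 := by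
  obtain ⟨k, rfl⟩ := Int.le.dest (hL.trans hK)
  rw [psi_add_sum_hinge L x hL k, min_eq_right hK, phi]

/-- The triangle with vertices `(p, 0)`, `(q, -n(q-p))`, `((np+mq)/(n+m), 0)` as an intersection
of three half-planes. -/
lemma mem_triangle_iff {n m p q : ℝ} (hn : 0 < n) (hm : 0 < m) (hpq : p ≤ q) (x y : ℝ) :
    (x, y) ∈ convexHull ℝ
        ({(p, 0), (q, -n * (q - p)), ((n * p + m * q) / (n + m), 0)} : Set (ℝ × ℝ)) ↔
      y ≤ 0 ∧ n * p ≤ y + n * x ∧ y + (n + m) * x ≤ n * p + m * q := by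
  have hnm : 0 < n + m := by positivity
  have hE : (n + m) * ((n * p + m * q) / (n + m)) = n * p + m * q := by field_simp
  set e := (n * p + m * q) / (n + m) with he
  constructor
  · intro h
    have hconv : Convex ℝ {z : ℝ × ℝ |
        z.2 ≤ 0 ∧ n * p ≤ z.2 + n * z.1 ∧ z.2 + (n + m) * z.1 ≤ n * p + m * q} := by
      rintro ⟨x₁, y₁⟩ ⟨a₁, b₁, c₁⟩ ⟨x₂, y₂⟩ ⟨a₂, b₂, c₂⟩ s t hs ht hst
      simp only [Set.mem_ofPred_eq, Prod.smul_mk, Prod.mk_add_mk, smul_eq_mul] at *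
      obtain rfl : s = 1 - t := by linarith
      refine ⟨?_, ?_, ?_⟩
      · nlinarith
      · nlinarith [mul_le_mul_of_nonneg_left b₁ hs, mul_le_mul_of_nonneg_left b₂ ht]
      · nlinarith [mul_le_mul_of_nonneg_left c₁ hs, mul_le_mul_of_nonneg_left c₂ ht]
    refine convexHull_min ?_ hconv h
    have hd : 0 ≤ q - p := sub_nonneg.mpr hpq
    have hnd := mul_nonneg hn.le hd
    have hmd := mul_nonneg hm.le hd
    have hpe : p ≤ e := by
      rw [he, le_div_iff₀ hnm]
      nlinarith
    rintro z (rfl | rfl | rfl)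
    · refine ⟨?_, ?_, ?_⟩ <;> simp only <;> nlinarith
    · refine ⟨?_, ?_, ?_⟩ <;> simp only <;> nlinarith
    · refine ⟨le_rfl, ?_, ?_⟩ <;> simp only <;> nlinarith
  · rintro ⟨hy, h₁, h₂⟩
    rcases hpq.eq_or_lt with rfl | hlt
    · have hxp : x ≤ p := le_of_mul_le_mul_left (by linarith) hm
      have hy0 : y = 0 := le_antisymm hy (by nlinarith)
      subst hy0
      have hx : x = p := le_antisymm hxp (le_of_mul_le_mul_left (by linarith) hn)
      subst hx
      exact subset_convexHull ℝ _ (by simp)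
    · have hd : 0 < q - p := sub_pos.mpr hlt
      have key := (convex_convexHull ℝ
        ({(p, 0), (q, -n * (q - p)), (e, 0)} : Set (ℝ × ℝ))).sum_mem
        (t := Finset.univ)
        (w := ![(n * p + m * q - (y + (n + m) * x)) / (m * (q - p)), -y / (n * (q - p)),
          (n + m) * (y + n * x - n * p) / (n * m * (q - p))])
        (z := ![(p, 0), (q, -n * (q - p)), (e, 0)]) ?_ ?_ ?_
      · convert key using 1
        simp only [Fin.sum_univ_three, Matrix.cons_val, Prod.smul_mk, Prod.mk_add_mk, smul_eq_mul]
        have := hd.ne'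
        ext
        · simp only [he]
          field_simp
          ring
        · simp only
          field_simp
          ring
      · intro i _
        fin_cases i
        · exact div_nonneg (by linarith) (by positivity)
        · exact div_nonneg (by linarith) (by positivity)
        · exact div_nonneg (mul_nonneg hnm.le (by linarith)) (by positivity)
      · simp only [Fin.sum_univ_three, Matrix.cons_val]
        have := hd.ne'
        field_simp
        ring
      · intro i _
        apply subset_convexHull
        fin_cases i <;> simp

/-- The hinge function at an integer, scaled so that its argument becomes an integer. -/
lemma mul_hinge_eq_cast {c x : ℝ} {k m : ℤ} (hc : 0 ≤ c) (h : c * (x - k) = m) :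
    c * max (x - k) 0 = ((max m 0 : ℤ) : ℝ) := by
  rw [mul_max_of_nonneg _ _ hc, h, mul_zero]
  push_cast
  rfl


/-- For `n₁, n₂` positive integers and rationals `p₁ ≤ p₂` with `n₁p₁, n₂p₂ ∈ ℤ`, there is
`ε₀ > 0` such that for all `0 < ε < ε₀` the number of pairs `(a,b) ∈ ℤ × ℤ` with
`(a+ε, b+ε)` in the triangle `T(p₁,p₂)` (the convex hull of `(p₁,0)`,
`(p₂, −n₁(p₂−p₁))` and `(E(p₁,p₂),0)`) is exactly
`λ(p₁,p₂) = n₁φ(p₁) + n₂φ(p₂) − (n₁+n₂)φ(E(p₁,p₂))`; in particular `λ(p₁,p₂)` is a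
nonnegative integer. -/
theorem statement_2 (n₁ n₂ : ℕ) (hn₁ : 0 < n₁) (hn₂ : 0 < n₂) (p₁ p₂ : ℚ)
    (h₁ : ∃ m : ℤ, (m : ℚ) = (n₁ : ℚ) * p₁) (h₂ : ∃ m : ℤ, (m : ℚ) = (n₂ : ℚ) * p₂)
    (hle : p₁ ≤ p₂) :
    (∃ ε₀ : ℝ, 0 < ε₀ ∧ ∀ ε : ℝ, 0 < ε → ε < ε₀ →
      (Set.ncard {q : ℤ × ℤ | ((q.1 : ℝ) + ε, (q.2 : ℝ) + ε) ∈
          convexHull ℝ ({((p₁ : ℝ), (0 : ℝ)),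
            ((p₂ : ℝ), -(n₁ : ℝ) * ((p₂ : ℝ) - (p₁ : ℝ))),
            (((n₁ : ℝ) * (p₁ : ℝ) + (n₂ : ℝ) * (p₂ : ℝ)) / ((n₁ : ℝ) + (n₂ : ℝ)), (0 : ℝ))} :
              Set (ℝ × ℝ))} : ℝ)
        = (n₁ : ℝ) * phi (p₁ : ℝ) + (n₂ : ℝ) * phi (p₂ : ℝ)
          - ((n₁ : ℝ) + (n₂ : ℝ)) *
              phi (((n₁ : ℝ) * (p₁ : ℝ) + (n₂ : ℝ) * (p₂ : ℝ)) / ((n₁ : ℝ) + (n₂ : ℝ)))) ∧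
    (∃ k : ℕ, (k : ℝ)
        = (n₁ : ℝ) * phi (p₁ : ℝ) + (n₂ : ℝ) * phi (p₂ : ℝ)
          - ((n₁ : ℝ) + (n₂ : ℝ)) *
              phi (((n₁ : ℝ) * (p₁ : ℝ) + (n₂ : ℝ) * (p₂ : ℝ)) / ((n₁ : ℝ) + (n₂ : ℝ)))) := by
  have hr₁ : (0 : ℝ) < n₁ := by exact_mod_cast hn₁
  have hr₂ : (0 : ℝ) < n₂ := by exact_mod_cast hn₂
  have hN : (0 : ℝ) < n₁ + n₂ := by positivity
  obtain ⟨m₁, hm₁⟩ := h₁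
  obtain ⟨m₂, hm₂⟩ := h₂
  replace hm₁ : (m₁ : ℝ) = n₁ * (p₁ : ℝ) := by exact_mod_cast congrArg (Rat.cast (K := ℝ)) hm₁
  replace hm₂ : (m₂ : ℝ) = n₂ * (p₂ : ℝ) := by exact_mod_cast congrArg (Rat.cast (K := ℝ)) hm₂
  replace hle : (p₁ : ℝ) ≤ p₂ := by exact_mod_cast hle
  generalize (p₁ : ℝ) = p at *
  generalize (p₂ : ℝ) = q at *
  set e := ((n₁ : ℝ) * p + n₂ * q) / (n₁ + n₂) with he
  have hE : ((n₁ : ℝ) + n₂) * e = n₁ * p + n₂ * q := by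
    rw [he]
    field_simp
  have hpe : p ≤ e := by
    rw [he, le_div_iff₀ hN]
    nlinarith
  have heq : e ≤ q := by
    rw [he, div_le_iff₀ hN]
    nlinarith
  set s : Finset (Σ _ : ℤ, ℤ) := (Finset.Ioc ⌊p⌋ ⌊q⌋).sigma
    (fun a => Finset.Ico (m₁ - n₁ * a) (min 0 (m₁ + m₂ - (n₁ + n₂) * a))) with hs
  have hcard : (s.card : ℝ) = n₁ * phi p + n₂ * phi q - (n₁ + n₂) * phi e := by
    rw [phi_eq_affine_add_sum_hinge le_rfl (Int.floor_mono hle),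
      phi_eq_affine_add_sum_hinge (Int.floor_mono hle) le_rfl,
      phi_eq_affine_add_sum_hinge (Int.floor_mono hpe) (Int.floor_mono heq)]
    have hsum : (s.card : ℝ) = ∑ a ∈ Finset.Ioc ⌊p⌋ ⌊q⌋,
        (n₁ * max (p - a) 0 + n₂ * max (q - a) 0 - (n₁ + n₂) * max (e - a) 0) := by
      rw [hs, Finset.card_sigma]
      push_cast
      refine Finset.sum_congr rfl fun a ha => ?_
      obtain ⟨hpa, haq⟩ := Finset.mem_Ioc.mp ha
      replace hpa : p < a := Int.floor_lt.mp hpa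
      replace haq : (a : ℝ) ≤ q := Int.le_floor.mp haq
      have hu : m₁ - n₁ * a ≤ 0 := by
        have : (m₁ : ℝ) - n₁ * a ≤ 0 := by nlinarith
        exact_mod_cast this
      have hv : 0 ≤ m₂ - n₂ * a := by
        have : (0 : ℝ) ≤ m₂ - n₂ * a := by nlinarith
        exact_mod_cast this
      rw [mul_hinge_eq_cast (m := m₁ - n₁ * a) hr₁.le (by push_cast; linarith),
        mul_hinge_eq_cast (m := m₂ - n₂ * a) hr₂.le (by push_cast; linarith),
        mul_hinge_eq_cast (m := (m₁ - n₁ * a) + (m₂ - n₂ * a)) hN.le (by push_cast; linarith),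
        Int.card_Ico, add_mul]
      generalize (n₁ : ℤ) * a = c at *
      generalize (n₂ : ℤ) * a = d at *
      have : ((min 0 (m₁ + m₂ - (c + d)) - (m₁ - c)).toNat : ℤ) =
        max (m₁ - c) 0 + max (m₂ - d) 0 - max ((m₁ - c) + (m₂ - d)) 0 := by omega
      exact_mod_cast this
    rw [hsum, Finset.sum_sub_distrib, Finset.sum_add_distrib, ← Finset.mul_sum,
      ← Finset.mul_sum, ← Finset.mul_sum]
    linear_combination (⌊p⌋ : ℝ) * hE
  refine ⟨⟨1 / (1 + n₁ + n₂), by positivity, fun ε hε hε₀ => ?_⟩, s.card, hcard⟩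
  rw [← hcard, ← Finset.card_map (Equiv.sigmaEquivProd ℤ ℤ).toEmbedding, ← Set.ncard_coe_finset]
  congr 2
  ext ⟨a, b⟩
  rw [lt_div_iff₀ (by positivity)] at hε₀
  have hεn₁ : 0 < ε * n₁ := by positivity
  have hεn₂ : 0 < ε * n₂ := by positivity
  have hb : (b : ℝ) + ε ≤ 0 ↔ b < 0 := by
    constructor <;> intro h
    · exact_mod_cast (by linarith : (b : ℝ) < 0)
    · have : (b : ℝ) + 1 ≤ 0 := by exact_mod_cast h
      nlinarith
  have hleft : (n₁ : ℝ) * p ≤ b + ε + n₁ * (a + ε) ↔ m₁ ≤ b + n₁ * a := by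
    rw [← hm₁]
    constructor <;> intro h
    · have : (m₁ : ℝ) < b + n₁ * a + 1 := by nlinarith
      exact Int.lt_add_one_iff.mp (by exact_mod_cast this)
    · have : (m₁ : ℝ) ≤ b + n₁ * a := by exact_mod_cast h
      nlinarith
  have hright : (b : ℝ) + ε + (n₁ + n₂) * (a + ε) ≤ n₁ * p + n₂ * q ↔
      b + (n₁ + n₂) * a < m₁ + m₂ := by
    rw [← hm₁, ← hm₂]
    constructor <;> intro h
    · have : (b : ℝ) + (n₁ + n₂) * a < m₁ + m₂ := by nlinarith
      exact_mod_cast this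
    · have : (b : ℝ) + (n₁ + n₂) * a + 1 ≤ m₁ + m₂ := by exact_mod_cast h
      nlinarith
  have hmem : (a, b) ∈ s.map (Equiv.sigmaEquivProd ℤ ℤ).toEmbedding ↔
      (⌊p⌋ < a ∧ a ≤ ⌊q⌋) ∧
        m₁ - n₁ * a ≤ b ∧ b < min 0 (m₁ + m₂ - (n₁ + n₂) * a) := by
    rw [Finset.mem_map_equiv, hs, Finset.mem_sigma, Finset.mem_Ioc, Finset.mem_Ico]
    rfl
  rw [Set.mem_ofPred_eq, mem_triangle_iff hr₁ hr₂ hle, hb, hleft, hright, Finset.mem_coe, hmem,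
    lt_min_iff]
  constructor
  · rintro ⟨h0, hl, hr⟩
    refine ⟨⟨Int.floor_lt.mpr ?_, Int.le_floor.mpr ?_⟩, by linarith, h0, by linarith⟩
    · have : (m₁ : ℝ) < n₁ * a := by exact_mod_cast (by linarith : m₁ < n₁ * a)
      exact lt_of_mul_lt_mul_left (by linarith) hr₁.le
    · have : (n₂ : ℝ) * a ≤ m₂ := by exact_mod_cast (by linarith : n₂ * a ≤ m₂)
      exact le_of_mul_le_mul_left (by linarith) hr₂
  · rintro ⟨-, hl, h0, hr⟩
    exact ⟨h0, by linarith, by linarith⟩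
end

section
/- Let n₁, n₂ be positive integers and p₁, p₂ real numbers. The two-dimensional Lebesgue measure of the triangle T(p₁,p₂), i.e. of the convex hull in ℝ² of the three points (p₁,0), (p₂, −n₁(p₂−p₁)), and (E(p₁,p₂), 0), equals n₁ψ(p₁) + n₂ψ(p₂) − (n₁+n₂)ψ(E(p₁,p₂)), where ψ(x) = x(x−1)/2 and E(p₁,p₂) = (n₁p₁ + n₂p₂)/(n₁+n₂). Equivalently, this area equals n₁n₂(p₂−p₁)²/(2(n₁+n₂)). -/
/-- The standard triangle in the plane, as the convex hull of its vertices. -/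
theorem convexHull_standard_triangle :
    convexHull ℝ ({(0, 0), (1, 0), (0, 1)} : Set (ℝ × ℝ))
      = {p | 0 ≤ p.1 ∧ 0 ≤ p.2 ∧ p.1 + p.2 ≤ 1} := by
  apply Set.Subset.antisymm
  · apply convexHull_min
    · rintro p (rfl | rfl | rfl) <;> norm_num
    · rintro p ⟨hp₁, hp₂, hp⟩ q ⟨hq₁, hq₂, hq⟩ a b ha hb hab
      simp only [Set.mem_ofPred_eq, Prod.fst_add, Prod.snd_add, Prod.smul_fst, Prod.smul_snd,
        smul_eq_mul]
      refine ⟨by positivity, by positivity, ?_⟩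
      nlinarith [mul_le_mul_of_nonneg_left hp ha, mul_le_mul_of_nonneg_left hq hb]
  · rintro ⟨x, y⟩ ⟨hx, hy, hxy⟩
    have hmem : ∀ p ∈ ({(0, 0), (1, 0), (0, 1)} : Set (ℝ × ℝ)),
        p ∈ convexHull ℝ ({(0, 0), (1, 0), (0, 1)} : Set (ℝ × ℝ)) :=
      fun p hp => subset_convexHull ℝ _ hp
    have h := (convex_convexHull ℝ ({(0, 0), (1, 0), (0, 1)} : Set (ℝ × ℝ))).sum_mem
      (t := Finset.univ) (w := ![1 - x - y, x, y]) (z := ![(0, 0), (1, 0), (0, 1)])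
      (by
        simp only [Finset.mem_univ, forall_const, Fin.forall_fin_succ]
        simp only [Matrix.cons_val_zero, Matrix.cons_val_succ, IsEmpty.forall_iff, and_true]
        exact ⟨by dsimp at hxy; linarith, hx, hy⟩)
      (by simp [Fin.sum_univ_succ])
      (by
        simp only [Finset.mem_univ, forall_const, Fin.forall_fin_succ]
        simp only [Matrix.cons_val_zero, Matrix.cons_val_succ, IsEmpty.forall_iff, and_true]
        exact ⟨hmem _ (by simp), hmem _ (by simp), hmem _ (by simp)⟩)
    simpa [Fin.sum_univ_succ] using h

open MeasureTheory in
theorem volume_convexHull_standard_triangle :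
    volume (convexHull ℝ ({(0, 0), (1, 0), (0, 1)} : Set (ℝ × ℝ))) = ENNReal.ofReal (1 / 2) := by
  rw [convexHull_standard_triangle]
  have hmeas : MeasurableSet {p : ℝ × ℝ | 0 ≤ p.1 ∧ 0 ≤ p.2 ∧ p.1 + p.2 ≤ 1} := by
    measurability
  have hslice : ∀ x : ℝ,
      volume (Prod.mk x ⁻¹' {p : ℝ × ℝ | 0 ≤ p.1 ∧ 0 ≤ p.2 ∧ p.1 + p.2 ≤ 1})
        = (Set.Icc (0 : ℝ) 1).indicator (fun x => ENNReal.ofReal (1 - x)) x := by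
    intro x
    by_cases hx : x ∈ Set.Icc (0 : ℝ) 1
    · have : Prod.mk x ⁻¹' {p : ℝ × ℝ | 0 ≤ p.1 ∧ 0 ≤ p.2 ∧ p.1 + p.2 ≤ 1}
          = Set.Icc 0 (1 - x) := by
        ext y
        simp [hx.1, le_sub_iff_add_le']
      rw [this, Set.indicator_of_mem hx, Real.volume_Icc, sub_zero]
    · have : Prod.mk x ⁻¹' {p : ℝ × ℝ | 0 ≤ p.1 ∧ 0 ≤ p.2 ∧ p.1 + p.2 ≤ 1} = ∅ := by
        ext y
        simp only [Set.mem_preimage, Set.mem_ofPred_eq, Set.mem_empty_iff_false, iff_false]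
        rintro ⟨h₁, h₂, h₃⟩
        exact hx ⟨h₁, by linarith⟩
      rw [this, Set.indicator_of_notMem hx, measure_empty]
  rw [Measure.volume_eq_prod, Measure.prod_apply hmeas]
  simp_rw [hslice]
  rw [lintegral_indicator measurableSet_Icc, ← ofReal_integral_eq_lintegral_ofReal]
  · rw [integral_Icc_eq_integral_Ioc, ← intervalIntegral.integral_of_le zero_le_one]
    congr 1
    rw [intervalIntegral.integral_sub (by simp) (by simp)]
    norm_num
  · exact (by fun_prop : Continuous fun x : ℝ => 1 - x).integrableOn_Icc
  · filter_upwards [ae_restrict_mem measurableSet_Icc] with x hx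
    exact sub_nonneg.mpr hx.2

open MeasureTheory Pointwise in
/-- The area of a (possibly degenerate) triangle in terms of the coordinates of its vertices. -/
theorem volume_convexHull_triangle (a b c : ℝ × ℝ) :
    volume (convexHull ℝ ({a, b, c} : Set (ℝ × ℝ)))
      = ENNReal.ofReal (|(b.1 - a.1) * (c.2 - a.2) - (c.1 - a.1) * (b.2 - a.2)| / 2) := by
  let M : Matrix (Fin 2) (Fin 2) ℝ := !![b.1 - a.1, c.1 - a.1; b.2 - a.2, c.2 - a.2]
  let L : ℝ × ℝ →ₗ[ℝ] ℝ × ℝ :=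
    Matrix.toLin (Module.Basis.finTwoProd ℝ) (Module.Basis.finTwoProd ℝ) M
  have hL : ∀ p : ℝ × ℝ, L p
      = ((b.1 - a.1) * p.1 + (c.1 - a.1) * p.2, (b.2 - a.2) * p.1 + (c.2 - a.2) * p.2) :=
    fun p => Matrix.toLin_finTwoProd_apply _ _ _ _ p
  have hdet : LinearMap.det L = (b.1 - a.1) * (c.2 - a.2) - (c.1 - a.1) * (b.2 - a.2) := by
    rw [LinearMap.det_toLin, Matrix.det_fin_two_of]
  have himage : ({a, b, c} : Set (ℝ × ℝ))
      = a +ᵥ (L '' ({(0, 0), (1, 0), (0, 1)} : Set (ℝ × ℝ))) := by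
    rw [← Set.image_vadd]
    simp only [Set.image_insert_eq, Set.image_singleton, hL, vadd_eq_add]
    congr <;> ext <;> simp
  rw [himage, convexHull_vadd, measure_vadd, ← LinearMap.image_convexHull,
    Measure.addHaar_image_linearMap, volume_convexHull_standard_triangle, hdet,
    ← ENNReal.ofReal_mul (abs_nonneg _), mul_one_div]

/-- The Lebesgue area of the triangle `T(p₁,p₂)`, the convex hull of `(p₁,0)`,
`(p₂, −n₁(p₂−p₁))` and `(E(p₁,p₂),0)` where `E(p₁,p₂) = (n₁p₁+n₂p₂)/(n₁+n₂)`, equals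
`n₁ψ(p₁) + n₂ψ(p₂) − (n₁+n₂)ψ(E(p₁,p₂))`, which in turn equals
`n₁n₂(p₂−p₁)²/(2(n₁+n₂))`. -/
theorem statement_3 (n₁ n₂ : ℕ) (hn₁ : 0 < n₁) (hn₂ : 0 < n₂) (p₁ p₂ : ℝ) :
    MeasureTheory.volume
        (convexHull ℝ ({(p₁, (0 : ℝ)),
          (p₂, -(n₁ : ℝ) * (p₂ - p₁)),
          (((n₁ : ℝ) * p₁ + (n₂ : ℝ) * p₂) / ((n₁ : ℝ) + (n₂ : ℝ)), (0 : ℝ))} : Set (ℝ × ℝ)))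
      = ENNReal.ofReal ((n₁ : ℝ) * psi p₁ + (n₂ : ℝ) * psi p₂
          - ((n₁ : ℝ) + (n₂ : ℝ)) * psi (((n₁ : ℝ) * p₁ + (n₂ : ℝ) * p₂) / ((n₁ : ℝ) + (n₂ : ℝ)))) ∧
    (n₁ : ℝ) * psi p₁ + (n₂ : ℝ) * psi p₂
        - ((n₁ : ℝ) + (n₂ : ℝ)) * psi (((n₁ : ℝ) * p₁ + (n₂ : ℝ) * p₂) / ((n₁ : ℝ) + (n₂ : ℝ)))
      = (n₁ : ℝ) * (n₂ : ℝ) * (p₂ - p₁) ^ 2 / (2 * ((n₁ : ℝ) + (n₂ : ℝ))) := by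
  have h₁ : (0 : ℝ) < n₁ := Nat.cast_pos.mpr hn₁
  have h₂ : (0 : ℝ) < n₂ := Nat.cast_pos.mpr hn₂
  have hne : (n₁ : ℝ) + n₂ ≠ 0 := by positivity
  have key : (n₁ : ℝ) * psi p₁ + (n₂ : ℝ) * psi p₂
      - ((n₁ : ℝ) + n₂) * psi (((n₁ : ℝ) * p₁ + (n₂ : ℝ) * p₂) / ((n₁ : ℝ) + n₂))
      = (n₁ : ℝ) * (n₂ : ℝ) * (p₂ - p₁) ^ 2 / (2 * ((n₁ : ℝ) + n₂)) := by
    unfold psi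
    field_simp
    ring
  refine ⟨?_, key⟩
  rw [key, volume_convexHull_triangle]
  congr 1
  have hdet : (p₂ - p₁) * (0 - 0)
      - (((n₁ : ℝ) * p₁ + n₂ * p₂) / (n₁ + n₂) - p₁) * (-(n₁ : ℝ) * (p₂ - p₁) - 0)
      = (n₁ : ℝ) * n₂ * (p₂ - p₁) ^ 2 / (n₁ + n₂) := by
    field_simp
    ring
  rw [hdet, abs_of_nonneg (by positivity)]
  field_simp
end

section
/- Let n₁, n₂ be positive integers. For all real numbers p₁, p₂ one has the weighted Jensen inequality (n₁+n₂)·φ((n₁p₁ + n₂p₂)/(n₁+n₂)) ≤ n₁φ(p₁) + n₂φ(p₂); that is, λ(p₁,p₂) = n₁φ(p₁) + n₂φ(p₂) − (n₁+n₂)φ(E(p₁,p₂)) is nonnegative. -/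
/-- The line of slope `m` through `(m, ψ(m))` supports `φ` from below. -/
lemma psi_add_mul_sub_le_phi (m : ℤ) (x : ℝ) : psi m + m * (x - m) ≤ phi x := by
  have hdiff : phi x - (psi m + m * (x - m))
      = ((⌊x⌋ : ℝ) - m) * (x - ((⌊x⌋ : ℝ) + m + 1) / 2) := by
    unfold phi psi
    ring
  have hle := Int.floor_le x
  have hlt := Int.lt_floor_add_one x
  rw [← sub_nonneg, hdiff]
  rcases lt_or_ge m ⌊x⌋ with h | h
  · have hm : (m : ℝ) + 1 ≤ ⌊x⌋ := by exact_mod_cast h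
    exact mul_nonneg (by linarith) (by linarith)
  · obtain h | h := h.eq_or_lt
    · simp [h]
    · have hm : (⌊x⌋ : ℝ) + 1 ≤ m := by exact_mod_cast h
      exact mul_nonneg_of_nonpos_of_nonpos (by linarith) (by linarith)

/-- Weighted Jensen inequality for `φ`: for positive integers `n₁, n₂` and reals `p₁, p₂`,
`(n₁+n₂)·φ((n₁p₁+n₂p₂)/(n₁+n₂)) ≤ n₁φ(p₁) + n₂φ(p₂)`; that is,
`λ(p₁,p₂) = n₁φ(p₁) + n₂φ(p₂) − (n₁+n₂)φ(E(p₁,p₂))` is nonnegative. -/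
theorem statement_5 (n₁ n₂ : ℕ) (hn₁ : 0 < n₁) (hn₂ : 0 < n₂) (p₁ p₂ : ℝ) :
    ((n₁ : ℝ) + (n₂ : ℝ)) * phi (((n₁ : ℝ) * p₁ + (n₂ : ℝ) * p₂) / ((n₁ : ℝ) + (n₂ : ℝ)))
        ≤ (n₁ : ℝ) * phi p₁ + (n₂ : ℝ) * phi p₂ ∧
    0 ≤ (n₁ : ℝ) * phi p₁ + (n₂ : ℝ) * phi p₂
        - ((n₁ : ℝ) + (n₂ : ℝ)) * phi (((n₁ : ℝ) * p₁ + (n₂ : ℝ) * p₂) / ((n₁ : ℝ) + (n₂ : ℝ))) := by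
  rw [sub_nonneg, and_self]
  have hn : (n₁ : ℝ) + n₂ ≠ 0 := by positivity
  set E := ((n₁ : ℝ) * p₁ + (n₂ : ℝ) * p₂) / ((n₁ : ℝ) + (n₂ : ℝ))
  have hmean : ((n₁ : ℝ) + n₂) * E = n₁ * p₁ + n₂ * p₂ := mul_div_cancel₀ _ hn
  calc ((n₁ : ℝ) + n₂) * phi E
      = n₁ * (psi ⌊E⌋ + ⌊E⌋ * (p₁ - ⌊E⌋)) + n₂ * (psi ⌊E⌋ + ⌊E⌋ * (p₂ - ⌊E⌋)) := by
        unfold phi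
        linear_combination (⌊E⌋ : ℝ) * hmean
    _ ≤ n₁ * phi p₁ + n₂ * phi p₂ := by
        gcongr <;> exact psi_add_mul_sub_le_phi _ _
end

section
/- Let n₁ be a positive integer, let q₁ and p₂ be integers, let r₁ be an integer with 0 ≤ r₁ < n₁, set p₁ = q₁ + r₁/n₁, and assume p₁ ≤ p₂. Then there exists ε₀ > 0 such that for every ε with 0 < ε < ε₀, the number of pairs (a,b) ∈ ℤ × ℤ for which (a+ε, b+ε) lies in the closed triangle in ℝ² with vertices (p₁, 0), (p₂, 0), and (p₂, −n₁(p₂−p₁)) equals n₁·N(N−1)/2 − r₁(N−1), where N = p₂ − q₁. -/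
/-- A right triangle with a horizontal leg ending in its right angle at `(q, 0)`, and hypotenuse of
slope `-n`, as an intersection of half-planes. -/
theorem mem_convexHull_right_triangle_iff {n p q : ℝ} (hn : 0 < n) (hpq : p ≤ q) (x y : ℝ) :
    (x, y) ∈ convexHull ℝ ({(p, 0), (q, 0), (q, -n * (q - p))} : Set (ℝ × ℝ)) ↔
      x ≤ q ∧ y ≤ 0 ∧ -n * (x - p) ≤ y := by
  constructor
  · intro h
    have hconv : Convex ℝ {z : ℝ × ℝ | z.1 ≤ q ∧ z.2 ≤ 0 ∧ -n * (z.1 - p) ≤ z.2} := by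
      rintro ⟨x₁, y₁⟩ ⟨h₁, h₂, h₃⟩ ⟨x₂, y₂⟩ ⟨k₁, k₂, k₃⟩ a b ha hb hab
      obtain rfl : b = 1 - a := by linarith
      simp only [Set.mem_ofPred_eq, Prod.smul_mk, Prod.mk_add_mk, smul_eq_mul] at *
      refine ⟨?_, ?_, ?_⟩
      · linarith [mul_le_mul_of_nonneg_left h₁ ha, mul_le_mul_of_nonneg_left k₁ hb]
      · linarith [mul_le_mul_of_nonneg_left h₂ ha, mul_le_mul_of_nonneg_left k₂ hb]
      · linarith [mul_le_mul_of_nonneg_left h₃ ha, mul_le_mul_of_nonneg_left k₃ hb]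
    refine convexHull_min ?_ hconv h
    have := mul_nonneg hn.le (sub_nonneg.2 hpq)
    rintro z (rfl | rfl | rfl) <;> refine ⟨?_, ?_, ?_⟩ <;> simp <;> linarith
  · rintro ⟨hx, hy, hxy⟩
    rcases hpq.eq_or_lt with rfl | hlt
    · obtain rfl : x = p := le_antisymm hx (by nlinarith)
      obtain rfl : y = 0 := le_antisymm hy (by simpa using hxy)
      exact subset_convexHull ℝ _ (by simp)
    · have hd : 0 < q - p := sub_pos.2 hlt
      have hc : 0 ≤ -y / (n * (q - p)) := by
        have := neg_nonneg.2 hy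
        positivity
      have hb : 0 ≤ (n * (x - p) + y) / (n * (q - p)) :=
        div_nonneg (by linarith) (by positivity)
      have ha : 0 ≤ (q - x) / (q - p) := div_nonneg (by linarith) hd.le
      have hsub := subset_convexHull ℝ ({(p, 0), (q, 0), (q, -n * (q - p))} : Set (ℝ × ℝ))
      have hmem := (convex_convexHull ℝ
        ({(p, 0), (q, 0), (q, -n * (q - p))} : Set (ℝ × ℝ))).sum_mem
        (t := Finset.univ)
        (w := ![(q - x) / (q - p), (n * (x - p) + y) / (n * (q - p)), -y / (n * (q - p))])
        (z := ![(p, 0), (q, 0), (q, -n * (q - p))])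
        (fun i _ => by fin_cases i <;> assumption)
        (by
          simp only [Fin.sum_univ_three, Matrix.cons_val]
          field_simp
          ring)
        (fun i _ => hsub (by fin_cases i <;> simp))
      convert hmem using 1
      simp only [Fin.sum_univ_three, Matrix.cons_val, Prod.smul_mk, Prod.mk_add_mk, smul_eq_mul,
        Prod.mk.injEq]
      constructor
      · field_simp
        ring
      · field_simp
        ring

/-- The number of lattice points below the `x`-axis, left of the line `x = p`, and on or above the
line through `(q, r)` of slope `-n`. -/
theorem ncard_lattice_points_triangle {n q p r : ℤ} (hr0 : 0 ≤ r) (hrn : r < n) (hqp : q < p) :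
    (Set.ncard {z : ℤ × ℤ | z.1 < p ∧ z.2 < 0 ∧ r - n * (z.1 - q) ≤ z.2} : ℤ) =
      n * ((p - q) * ((p - q) - 1) / 2) - r * ((p - q) - 1) := by
  have hset : {z : ℤ × ℤ | z.1 < p ∧ z.2 < 0 ∧ r - n * (z.1 - q) ≤ z.2} =
      (((Finset.Ico (q + 1) p).sigma fun a => Finset.Ico (r - n * (a - q)) 0).map
        (Equiv.sigmaEquivProd ℤ ℤ).toEmbedding : Finset (ℤ × ℤ)) := by
    ext ⟨a, b⟩
    simp only [Set.mem_ofPred_eq, Finset.coe_map, Set.mem_image, Finset.mem_coe, Finset.mem_sigma,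
      Finset.mem_Ico, Sigma.exists, Equiv.coe_toEmbedding, Equiv.sigmaEquivProd_apply,
      Prod.mk.injEq]
    constructor
    · rintro ⟨h₁, h₂, h₃⟩
      have : q < a := by
        by_contra! h
        nlinarith
      exact ⟨a, b, ⟨⟨this, h₁⟩, h₃, h₂⟩, rfl, rfl⟩
    · rintro ⟨a, b, ⟨⟨_, h₁⟩, h₃, h₂⟩, rfl, rfl⟩
      exact ⟨h₁, h₂, h₃⟩
  rw [hset, Set.ncard_coe_finset, Finset.card_map, Finset.card_sigma]
  simp only [Int.card_Ico, Nat.cast_sum]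
  have hsum : ∑ a ∈ Finset.Ico (q + 1) p, (((0 - (r - n * (a - q))).toNat : ℕ) : ℤ) =
      ∑ a ∈ Finset.Ico (q + 1) p, (n * (a - q) - r) := by
    refine Finset.sum_congr rfl fun a ha => ?_
    have := (Finset.mem_Ico.1 ha).1
    rw [Int.toNat_of_nonneg (by nlinarith)]
    ring
  rw [hsum]
  clear hsum hset
  induction p, (show q + 1 ≤ p from hqp) using Int.leInduction with
  | base => simp
  | succ p hp ih =>
    have hsplit : Finset.Ico (q + 1) (p + 1) = insert p (Finset.Ico (q + 1) p) := by
      ext a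
      simp only [Finset.mem_Ico, Finset.mem_insert]
      lia
    have hdiv : (p + 1 - q) * ((p + 1 - q) - 1) / 2 = (p - q) * ((p - q) - 1) / 2 + (p - q) := by
      rw [← Int.add_mul_ediv_right _ _ two_ne_zero]
      ring_nf
    rw [hsplit, Finset.sum_insert (by simp), ih hp, hdiv]
    ring


/-- Let `n₁` be a positive integer, `q₁, p₂` integers, `0 ≤ r₁ < n₁`, and
`p₁ = q₁ + r₁/n₁ ≤ p₂`. Then for all sufficiently small `ε > 0`, the number of pairs
`(a,b) ∈ ℤ × ℤ` with `(a+ε, b+ε)` in the closed triangle with vertices `(p₁,0)`, `(p₂,0)`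
and `(p₂, −n₁(p₂−p₁))` equals `n₁·N(N−1)/2 − r₁(N−1)` where `N = p₂ − q₁`. -/
theorem statement_7 (n₁ q₁ p₂ r₁ : ℤ) (hn₁ : 0 < n₁) (hr0 : 0 ≤ r₁) (hrn : r₁ < n₁)
    (p₁ : ℚ) (hp₁ : p₁ = (q₁ : ℚ) + (r₁ : ℚ) / (n₁ : ℚ)) (hle : p₁ ≤ (p₂ : ℚ)) :
    ∃ ε₀ : ℝ, 0 < ε₀ ∧ ∀ ε : ℝ, 0 < ε → ε < ε₀ →
      (Set.ncard {q : ℤ × ℤ | ((q.1 : ℝ) + ε, (q.2 : ℝ) + ε) ∈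
          convexHull ℝ ({((p₁ : ℝ), (0 : ℝ)), ((p₂ : ℝ), (0 : ℝ)),
            ((p₂ : ℝ), -(n₁ : ℝ) * ((p₂ : ℝ) - (p₁ : ℝ)))} : Set (ℝ × ℝ))} : ℤ)
        = n₁ * ((p₂ - q₁) * ((p₂ - q₁) - 1) / 2) - r₁ * ((p₂ - q₁) - 1) := by
  have hnR : (0 : ℝ) < n₁ := by exact_mod_cast hn₁
  have hpR : (p₁ : ℝ) ≤ p₂ := by exact_mod_cast hle
  have hmul : (n₁ : ℝ) * p₁ = n₁ * q₁ + r₁ := by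
    rw [hp₁]
    push_cast
    field_simp
  refine ⟨1 / (n₁ + 1), by positivity, fun ε hε hε' => ?_⟩
  have hεn : ε * (n₁ + 1) < 1 := (lt_div_iff₀ (by positivity)).1 hε'
  have hε1 : ε < 1 := by nlinarith
  have hset : {q : ℤ × ℤ | ((q.1 : ℝ) + ε, (q.2 : ℝ) + ε) ∈
      convexHull ℝ ({((p₁ : ℝ), (0 : ℝ)), ((p₂ : ℝ), (0 : ℝ)),
        ((p₂ : ℝ), -(n₁ : ℝ) * ((p₂ : ℝ) - (p₁ : ℝ)))} : Set (ℝ × ℝ))} =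
      {z : ℤ × ℤ | z.1 < p₂ ∧ z.2 < 0 ∧ r₁ - n₁ * (z.1 - q₁) ≤ z.2} := by
    ext ⟨a, b⟩
    simp only [Set.mem_ofPred_eq, mem_convexHull_right_triangle_iff hnR hpR]
    refine and_congr ⟨fun h => ?_, fun h => ?_⟩
      (and_congr ⟨fun h => ?_, fun h => ?_⟩ ⟨fun h => ?_, fun h => ?_⟩)
    · have : (a : ℝ) < p₂ := by linarith
      exact_mod_cast this
    · have : (a : ℝ) + 1 ≤ p₂ := by exact_mod_cast h
      linarith
    · have : (b : ℝ) < 0 := by linarith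
      exact_mod_cast this
    · have : (b : ℝ) + 1 ≤ 0 := by exact_mod_cast h
      linarith
    · have : (r₁ : ℝ) - n₁ * (a - q₁) < b + 1 := by linarith
      exact Int.lt_add_one_iff.1 (by exact_mod_cast this)
    · have : (r₁ : ℝ) - n₁ * (a - q₁) ≤ b := by exact_mod_cast h
      nlinarith
  rw [hset]
  have hqp : q₁ ≤ p₂ := by
    have : (n₁ : ℝ) * q₁ ≤ n₁ * p₂ := by
      have : (0 : ℝ) ≤ r₁ := by exact_mod_cast hr0
      nlinarith
    exact_mod_cast le_of_mul_le_mul_left this hnR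
  rcases hqp.eq_or_lt with rfl | hlt
  · obtain rfl : r₁ = 0 := by
      have : (r₁ : ℝ) ≤ 0 := by nlinarith
      exact le_antisymm (by exact_mod_cast this) hr0
    have : {z : ℤ × ℤ | z.1 < q₁ ∧ z.2 < 0 ∧ 0 - n₁ * (z.1 - q₁) ≤ z.2} = ∅ := by
      ext ⟨a, b⟩
      simp only [Set.mem_ofPred_eq, Set.mem_empty_iff_false, iff_false]
      rintro ⟨h₁, h₂, h₃⟩
      nlinarith
    rw [this]
    simp
  · exact ncard_lattice_points_triangle hr0 hrn hlt
end

section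
/- Let n₁ be a positive integer, let q₁ be an integer, let r₁ be an integer with 0 ≤ r₁ < n₁, set p₁ = q₁ + r₁/n₁, and let p₂ be a rational number which is not an integer and satisfies p₁ ≤ p₂. Then there exists ε₀ > 0 such that for every ε with 0 < ε < ε₀, the number of pairs (a,b) ∈ ℤ × ℤ for which (a+ε, b+ε) lies in the closed triangle in ℝ² with vertices (p₁, 0), (p₂, 0), and (p₂, −n₁(p₂−p₁)) equals n₁·M(M+1)/2 − r₁·M, where M = ⌊p₂⌋ − q₁. -/
theorem mem_convexHull_right_triangle_of_le {p r n x y : ℝ} (hn : 0 < n) (hpr : p < r)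
    (hx : x ≤ r) (hy : y ≤ 0) (hxy : -n * (x - p) ≤ y) :
    (x, y) ∈ convexHull ℝ ({(p, 0), (r, 0), (r, -n * (r - p))} : Set (ℝ × ℝ)) := by
  have hd : 0 < r - p := sub_pos.mpr hpr
  have hnd : 0 < n * (r - p) := mul_pos hn hd
  have hsum := (convex_convexHull ℝ
      ({(p, 0), (r, 0), (r, -n * (r - p))} : Set (ℝ × ℝ))).sum_mem (t := Finset.univ)
    (w := ![(r - x) / (r - p), (n * (x - p) + y) / (n * (r - p)), -y / (n * (r - p))])
    (z := ![(p, 0), (r, 0), (r, -n * (r - p))]) ?_ ?_ ?_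
  · convert hsum using 1
    simp only [Fin.sum_univ_three, Matrix.cons_val_zero, Matrix.cons_val_one,
      Matrix.cons_val, Prod.smul_mk, smul_eq_mul, Prod.mk_add_mk]
    ext
    · field_simp
      ring
    · field_simp
      ring
  · intro i _
    fin_cases i
    · exact div_nonneg (by linarith) hd.le
    · exact div_nonneg (by linarith) hnd.le
    · exact div_nonneg (by linarith) hnd.le
  · simp only [Fin.sum_univ_three, Matrix.cons_val_zero, Matrix.cons_val_one, Matrix.cons_val]
    field_simp
    ring
  · intro i _
    apply subset_convexHull
    fin_cases i <;> simp

theorem le_of_mem_convexHull_right_triangle {p r n x y : ℝ} (hn : 0 < n) (hpr : p ≤ r)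
    (h : (x, y) ∈ convexHull ℝ ({(p, 0), (r, 0), (r, -n * (r - p))} : Set (ℝ × ℝ))) :
    x ≤ r ∧ y ≤ 0 ∧ -n * (x - p) ≤ y := by
  have hconv : Convex ℝ {z : ℝ × ℝ | z.1 ≤ r ∧ z.2 ≤ 0 ∧ -n * (z.1 - p) ≤ z.2} := by
    rintro ⟨x₁, y₁⟩ ⟨h₁, h₂, h₃⟩ ⟨x₂, y₂⟩ ⟨h₄, h₅, h₆⟩ a b ha hb hab
    obtain rfl : b = 1 - a := by linarith
    simp only [Set.mem_ofPred_eq, Prod.smul_mk, smul_eq_mul, Prod.mk_add_mk] at *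
    refine ⟨?_, ?_, ?_⟩
    · nlinarith
    · nlinarith
    · nlinarith [mul_le_mul_of_nonneg_left h₃ ha, mul_le_mul_of_nonneg_left h₆ hb]
  refine convexHull_min ?_ hconv h
  have hnd : 0 ≤ n * (r - p) := mul_nonneg hn.le (sub_nonneg.mpr hpr)
  rintro z (rfl | rfl | rfl)
  · simpa using hpr
  · simpa using hnd
  · simpa using hnd

theorem sum_range_mul_succ_sub (n r : ℤ) (N : ℕ) :
    ∑ k ∈ Finset.range N, (n * ((k : ℤ) + 1) - r) = n * ((N : ℤ) * (N + 1) / 2) - r * N := by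
  have h : (N : ℤ) * (N + 1) / 2 = ∑ k ∈ Finset.range N, ((k : ℤ) + 1) := by
    refine Int.ediv_eq_of_eq_mul_left two_ne_zero ?_
    induction N with
    | zero => simp
    | succ N ih =>
      rw [Finset.sum_range_succ, add_mul, ← ih]
      push_cast
      ring
  rw [h, Finset.sum_sub_distrib, ← Finset.mul_sum]
  simp [mul_comm]


/-- Let `n₁` be a positive integer, `q₁` an integer, `0 ≤ r₁ < n₁`, `p₁ = q₁ + r₁/n₁`, and
let `p₂` be a non-integral rational with `p₁ ≤ p₂`. Then for all sufficiently small `ε > 0`,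
the number of pairs `(a,b) ∈ ℤ × ℤ` with `(a+ε, b+ε)` in the closed triangle with vertices
`(p₁,0)`, `(p₂,0)` and `(p₂, −n₁(p₂−p₁))` equals `n₁·M(M+1)/2 − r₁·M` where
`M = ⌊p₂⌋ − q₁`. -/
theorem statement_8 (n₁ q₁ r₁ : ℤ) (hn₁ : 0 < n₁) (hr0 : 0 ≤ r₁) (hrn : r₁ < n₁)
    (p₁ p₂ : ℚ) (hp₁ : p₁ = (q₁ : ℚ) + (r₁ : ℚ) / (n₁ : ℚ))
    (hp₂ : ¬ ∃ m : ℤ, (m : ℚ) = p₂) (hle : p₁ ≤ p₂) :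
    ∃ ε₀ : ℝ, 0 < ε₀ ∧ ∀ ε : ℝ, 0 < ε → ε < ε₀ →
      (Set.ncard {q : ℤ × ℤ | ((q.1 : ℝ) + ε, (q.2 : ℝ) + ε) ∈
          convexHull ℝ ({((p₁ : ℝ), (0 : ℝ)), ((p₂ : ℝ), (0 : ℝ)),
            ((p₂ : ℝ), -(n₁ : ℝ) * ((p₂ : ℝ) - (p₁ : ℝ)))} : Set (ℝ × ℝ))} : ℤ)
        = n₁ * ((⌊p₂⌋ - q₁) * ((⌊p₂⌋ - q₁) + 1) / 2) - r₁ * (⌊p₂⌋ - q₁) := by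
  have hn₁' : (0 : ℝ) < n₁ := by exact_mod_cast hn₁
  have hnp : (n₁ : ℝ) * p₁ = n₁ * q₁ + r₁ := by
    rw [hp₁]
    push_cast
    field_simp
  have hle' : (p₁ : ℝ) ≤ p₂ := by exact_mod_cast hle
  have hq : (q₁ : ℝ) ≤ p₁ := by
    have : (0 : ℝ) ≤ r₁ := by exact_mod_cast hr0
    nlinarith
  have hq' : (p₁ : ℝ) < q₁ + 1 := by
    have : (r₁ : ℝ) < n₁ := by exact_mod_cast hrn
    nlinarith
  set m := ⌊p₂⌋ with hm
  have hmp : (m : ℝ) < p₂ := by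
    have : (m : ℚ) < p₂ := (Int.floor_le p₂).lt_of_ne fun h => hp₂ ⟨m, h⟩
    exact_mod_cast this
  have hqm : q₁ ≤ m := Int.le_floor.mpr (by exact_mod_cast hq.trans hle')
  obtain ⟨N, hN⟩ := Int.eq_ofNat_of_zero_le (sub_nonneg.mpr hqm)
  refine ⟨min (1 / (n₁ + 1)) (p₂ - m), by
    apply lt_min
    · positivity
    · linarith, fun ε hε hε' => ?_⟩
  obtain ⟨h₁, h₂⟩ := lt_min_iff.mp hε'
  rw [lt_div_iff₀ (by positivity)] at h₁
  have hε₁ : ε < 1 := by nlinarith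
  have hset : {q : ℤ × ℤ | ((q.1 : ℝ) + ε, (q.2 : ℝ) + ε) ∈
      convexHull ℝ ({((p₁ : ℝ), (0 : ℝ)), ((p₂ : ℝ), (0 : ℝ)),
        ((p₂ : ℝ), -(n₁ : ℝ) * ((p₂ : ℝ) - (p₁ : ℝ)))} : Set (ℝ × ℝ))} =
      (((Finset.range N).sigma fun k : ℕ => Finset.Icc (r₁ - n₁ * ((k : ℤ) + 1)) (-1)).image
        fun s => (q₁ + 1 + (s.1 : ℤ), s.2) : Finset (ℤ × ℤ)) := by
    ext ⟨a, b⟩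
    simp only [Set.mem_ofPred_eq, Finset.coe_image, Set.mem_image, Finset.mem_coe,
      Finset.mem_sigma, Finset.mem_range, Finset.mem_Icc, Prod.mk.injEq, Sigma.exists]
    constructor
    · intro h
      obtain ⟨hx, hy, hxy⟩ := le_of_mem_convexHull_right_triangle hn₁' hle' h
      have ham : a ≤ m := by
        apply Int.le_floor.mpr
        have : (a : ℝ) ≤ p₂ := by linarith
        exact_mod_cast this
      have hb : b < 0 := by
        have : (b : ℝ) < 0 := by linarith
        exact_mod_cast this
      have hab : r₁ - n₁ * (a - q₁) < b + 1 := by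
        have : (r₁ : ℝ) - n₁ * (a - q₁) < b + 1 := by nlinarith
        exact_mod_cast this
      have hqa : q₁ < a := by
        by_contra! hc
        have := mul_nonneg hn₁.le (sub_nonneg.mpr hc)
        linarith
      obtain ⟨k, hk⟩ := Int.eq_ofNat_of_zero_le (sub_nonneg.mpr (Int.add_one_le_of_lt hqa))
      have hka : (k : ℤ) + 1 = a - q₁ := by omega
      refine ⟨k, b, ⟨by omega, ?_, by omega⟩, by omega, rfl⟩
      rw [hka]
      omega
    · rintro ⟨k, b, ⟨hk, hb, hb'⟩, rfl, rfl⟩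
      have ham : ((q₁ + 1 + (k : ℤ) : ℤ) : ℝ) ≤ m := by
        exact_mod_cast (by omega : q₁ + 1 + (k : ℤ) ≤ m)
      have hk0 : (0 : ℝ) ≤ k := Nat.cast_nonneg k
      have hbr : (r₁ : ℝ) - n₁ * (k + 1) ≤ b := by exact_mod_cast hb
      have hbr' : (b : ℝ) ≤ -1 := by exact_mod_cast hb'
      push_cast at ham ⊢
      apply mem_convexHull_right_triangle_of_le hn₁'
      · linarith
      · linarith
      · linarith
      · nlinarith
  have hinj : Function.Injective
      fun s : (_ : ℕ) × ℤ => ((q₁ + 1 + (s.1 : ℤ), s.2) : ℤ × ℤ) := by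
    rintro ⟨k, b⟩ ⟨k', b'⟩ h
    simp only [Prod.mk.injEq, add_right_inj, Nat.cast_inj] at h
    rw [h.1, h.2]
  rw [hset, Set.ncard_coe_finset, Finset.card_image_of_injective _ hinj, Finset.card_sigma, hN,
    ← sum_range_mul_succ_sub, Nat.cast_sum]
  refine Finset.sum_congr rfl fun k _ => ?_
  have : n₁ * 1 ≤ n₁ * ((k : ℤ) + 1) := mul_le_mul_of_nonneg_left (by omega) hn₁.le
  rw [Int.card_Icc, Int.toNat_of_nonneg (by linarith)]
  ring
end

section
/- Let R be a commutative ring and let φ : R[X,Y] → R[z] be the R-algebra homomorphism from the polynomial ring in two variables to the polynomial ring in one variable determined by X ↦ z² and Y ↦ z³. Then the kernel of φ is exactly the ideal of R[X,Y] generated by Y² − X³. -/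
open MvPolynomial

/-- If `y² = x³` in an `R`-algebra `A`, then `z ^ (2a + 3b) ↦ x ^ a * y ^ b` extends to an
`R`-linear map `R[z] → A`. -/
theorem exists_linearMap_of_sq_eq_cube {R A : Type*} [CommRing R] [CommRing A] [Algebra R A]
    {x y : A} (h : y ^ 2 = x ^ 3) :
    ∃ s : Polynomial R →ₗ[R] A,
      ∀ a b : ℕ, s (Polynomial.X ^ (2 * a + 3 * b)) = x ^ a * y ^ b := by
  refine ⟨(Polynomial.basisMonomials R).constr R
    fun n => if Even n then x ^ (n / 2) else x ^ ((n - 3) / 2) * y, fun a b => ?_⟩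
  rw [Polynomial.X_pow_eq_monomial,
    ← congrFun (Polynomial.coe_basisMonomials R) (2 * a + 3 * b), Module.Basis.constr_basis]
  obtain ⟨c, rfl | rfl⟩ := b.even_or_odd'
  · have heven : Even (2 * a + 3 * (2 * c)) := ⟨a + 3 * c, by ring⟩
    rw [if_pos heven, show (2 * a + 3 * (2 * c)) / 2 = a + 3 * c by omega, pow_mul, h]
    ring
  · have hodd : ¬ Even (2 * a + 3 * (2 * c + 1)) := by
      rw [Nat.not_even_iff_odd]
      exact ⟨a + 3 * c + 1, by ring⟩
    rw [if_neg hodd, show (2 * a + 3 * (2 * c + 1) - 3) / 2 = a + 3 * c by omega, pow_succ y,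
      pow_mul, h]
    ring

/-- The kernel of the `R`-algebra homomorphism `R[X,Y] → R[z]`, `X ↦ z²`, `Y ↦ z³`,
is the ideal generated by `Y² − X³`. -/
theorem statement_9 (R : Type*) [CommRing R] :
    RingHom.ker (MvPolynomial.aeval ![Polynomial.X ^ 2, Polynomial.X ^ 3] :
        MvPolynomial (Fin 2) R →ₐ[R] Polynomial R)
      = Ideal.span {(X 1 : MvPolynomial (Fin 2) R) ^ 2 - X 0 ^ 3} := by
  set I := Ideal.span {(X 1 : MvPolynomial (Fin 2) R) ^ 2 - X 0 ^ 3} with hI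
  set φ := (MvPolynomial.aeval ![Polynomial.X ^ 2, Polynomial.X ^ 3] :
    MvPolynomial (Fin 2) R →ₐ[R] Polynomial R) with hφ
  apply le_antisymm
  · have hrel : Ideal.Quotient.mkₐ R I (X 1) ^ 2 = Ideal.Quotient.mkₐ R I (X 0) ^ 3 := by
      rw [← map_pow, ← map_pow]
      exact Ideal.Quotient.eq.mpr (Ideal.subset_span rfl)
    obtain ⟨s, hs⟩ := exists_linearMap_of_sq_eq_cube (R := R) hrel
    have hcomp : s ∘ₗ φ.toLinearMap = (Ideal.Quotient.mkₐ R I).toLinearMap := by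
      refine (basisMonomials (Fin 2) R).ext fun m => ?_
      have hm : monomial m (1 : R) = X 0 ^ m 0 * X 1 ^ m 1 := by
        rw [monomial_eq, Finsupp.prod_fintype _ _ fun _ => pow_zero _]
        simp
      have hφm : φ (monomial m 1) = Polynomial.X ^ (2 * m 0 + 3 * m 1) := by
        simp [hφ, hm, pow_add, pow_mul]
      simp only [coe_basisMonomials, LinearMap.comp_apply, AlgHom.toLinearMap_apply, hφm, hs]
      rw [hm, map_mul, map_pow, map_pow]
    intro f hf
    have hf0 : φ f = 0 := hf
    have hsf := LinearMap.congr_fun hcomp f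
    rw [LinearMap.comp_apply, AlgHom.toLinearMap_apply, hf0, map_zero] at hsf
    exact Ideal.Quotient.eq_zero_iff_mem.mp hsf.symm
  · rw [hI, Ideal.span_singleton_le_iff_mem, RingHom.mem_ker]
    simp only [hφ, map_sub, map_pow, aeval_X, Matrix.cons_val_zero, Matrix.cons_val_one]
    ring
end

section
/- Let R be a commutative ring and let ν : R[X,Y] → R[t] × R[t] be the R-algebra homomorphism determined by X ↦ (t, 0) and Y ↦ (0, t) (equivalently, ν(f) = (f(t,0), f(0,t))). Then the kernel of ν is exactly the ideal of R[X,Y] generated by XY, and the range of ν is exactly the set of pairs (f, g) ∈ R[t] × R[t] with f(0) = g(0). -/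
open MvPolynomial

theorem fst_aeval_node {R : Type*} [CommRing R] (p : MvPolynomial (Fin 2) R) :
    (aeval ![((Polynomial.X : Polynomial R), (0 : Polynomial R)), (0, Polynomial.X)] p).1
      = aeval ![(Polynomial.X : Polynomial R), 0] p := by
  refine DFunLike.congr_fun
    (f := (AlgHom.fst R (Polynomial R) (Polynomial R)).comp (aeval (R := R) _)) ?_ p
  ext i : 1
  fin_cases i <;> simp

theorem snd_aeval_node {R : Type*} [CommRing R] (p : MvPolynomial (Fin 2) R) :
    (aeval ![((Polynomial.X : Polynomial R), (0 : Polynomial R)), (0, Polynomial.X)] p).2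
      = aeval ![0, (Polynomial.X : Polynomial R)] p := by
  refine DFunLike.congr_fun
    (f := (AlgHom.snd R (Polynomial R) (Polynomial R)).comp (aeval (R := R) _)) ?_ p
  ext i : 1
  fin_cases i <;> simp

theorem eval_zero_aeval_X_zero {R : Type*} [CommRing R] (p : MvPolynomial (Fin 2) R) :
    (aeval ![(Polynomial.X : Polynomial R), 0] p).eval 0
      = (aeval ![0, (Polynomial.X : Polynomial R)] p).eval 0 := by
  rw [← Polynomial.coe_aeval_eq_eval]
  refine DFunLike.congr_fun (f := (Polynomial.aeval (0 : R)).comp (aeval _))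
    (g := (Polynomial.aeval (0 : R)).comp (aeval _)) ?_ p
  ext i : 1
  fin_cases i <;> simp

theorem dvd_aeval_sub_algebraMap_eval_zero {R A : Type*} [CommRing R] [CommRing A] [Algebra R A]
    (a : A) (f : Polynomial R) :
    a ∣ Polynomial.aeval a f - algebraMap R A (f.eval 0) := by
  have h : Polynomial.X ∣ f - Polynomial.C (f.eval 0) := by
    simp [Polynomial.X_dvd_iff, Polynomial.coeff_zero_eq_eval_zero]
  simpa using map_dvd (Polynomial.aeval a) h

/-- Modulo `XY`, every polynomial `p` equals `p(X,0) + p(0,Y) - p(0,0)`. -/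
theorem X_mul_X_dvd_sub {R : Type*} [CommRing R] (p : MvPolynomial (Fin 2) R) :
    (X 0 * X 1 : MvPolynomial (Fin 2) R) ∣
      p - (Polynomial.aeval (X 0) (aeval ![(Polynomial.X : Polynomial R), 0] p)
        + Polynomial.aeval (X 1) (aeval ![0, (Polynomial.X : Polynomial R)] p)
        - C ((aeval ![(Polynomial.X : Polynomial R), 0] p).eval 0)) := by
  induction p using MvPolynomial.induction_on with
  | C a => simp [MvPolynomial.algebraMap_eq]
  | add p q hp hq =>
    convert dvd_add hp hq using 1
    simp only [map_add, Polynomial.eval_add]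
    ring
  | mul_X p i hp =>
    have hf := dvd_aeval_sub_algebraMap_eval_zero (X 0 : MvPolynomial (Fin 2) R)
      (aeval ![(Polynomial.X : Polynomial R), 0] p)
    have hg := dvd_aeval_sub_algebraMap_eval_zero (X 1 : MvPolynomial (Fin 2) R)
      (aeval ![0, (Polynomial.X : Polynomial R)] p)
    rw [← eval_zero_aeval_X_zero] at hg
    rw [MvPolynomial.algebraMap_eq] at hf hg
    fin_cases i
    · convert dvd_add (hp.mul_right (X 0)) (mul_dvd_mul_left (X 0) hg) using 1
      simp
      ring
    · convert dvd_add (hp.mul_right (X 1)) (mul_dvd_mul_right hf (X 1)) using 1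
      simp
      ring

/-- For the `R`-algebra homomorphism `ν : R[X,Y] → R[t] × R[t]`, `X ↦ (t,0)`, `Y ↦ (0,t)`
(i.e. `ν(f) = (f(t,0), f(0,t))`), the kernel is the ideal generated by `XY`, and the range
is exactly the set of pairs `(f,g)` with `f(0) = g(0)`. -/
theorem statement_11 (R : Type*) [CommRing R] :
    RingHom.ker (MvPolynomial.aeval
          ![((Polynomial.X : Polynomial R), (0 : Polynomial R)),
            ((0 : Polynomial R), (Polynomial.X : Polynomial R))] :
        MvPolynomial (Fin 2) R →ₐ[R] Polynomial R × Polynomial R)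
      = Ideal.span {(X 0 : MvPolynomial (Fin 2) R) * X 1} ∧
    ∀ fg : Polynomial R × Polynomial R,
      fg ∈ (MvPolynomial.aeval
          ![((Polynomial.X : Polynomial R), (0 : Polynomial R)),
            ((0 : Polynomial R), (Polynomial.X : Polynomial R))] :
        MvPolynomial (Fin 2) R →ₐ[R] Polynomial R × Polynomial R).range
      ↔ fg.1.eval 0 = fg.2.eval 0 := by
  refine ⟨?_, fun fg => ⟨?_, fun h => ?_⟩⟩
  · ext p
    rw [RingHom.mem_ker, Ideal.mem_span_singleton]
    refine ⟨fun h => ?_, fun h => ?_⟩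
    · have h₁ := congrArg Prod.fst h
      have h₂ := congrArg Prod.snd h
      rw [fst_aeval_node] at h₁
      rw [snd_aeval_node] at h₂
      simpa [h₁, h₂] using X_mul_X_dvd_sub p
    · obtain ⟨q, rfl⟩ := h
      rw [map_mul, map_mul, aeval_X, aeval_X]
      ext1 <;> simp
  · rintro ⟨p, rfl⟩
    simpa [fst_aeval_node, snd_aeval_node] using eval_zero_aeval_X_zero p
  · obtain ⟨f, g⟩ := fg
    refine ⟨Polynomial.aeval (X 0) f + Polynomial.aeval (X 1) g - C (f.eval 0), ?_⟩
    have h0 (q : Polynomial R) : Polynomial.aeval (0 : Polynomial R) q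
        = Polynomial.C (q.eval 0) := by
      simpa using Polynomial.aeval_algebraMap_apply (Polynomial R) (0 : R) q
    refine Prod.ext ((fst_aeval_node _).trans ?_) ((snd_aeval_node _).trans ?_)
    · simp [← Polynomial.aeval_algHom_apply, h0, h]
    · simp [← Polynomial.aeval_algHom_apply, h0]
end

section
/- Let R be a commutative ring and let π : R[X,Y] → R[s] be the R-algebra homomorphism determined by X ↦ s² − s and Y ↦ s³ − 2s² + s (i.e. X ↦ s(s−1), Y ↦ s(s−1)²). Then the kernel of π is exactly the ideal of R[X,Y] generated by Y² + XY − X³, and the range of π is exactly the set of polynomials f ∈ R[s] with f(0) = f(1). (This is the affine form of the parametrization [s:t] ↦ [st(s−t) : s(s−t)² : t³] identifying ℙ¹ with the two points [0:1], [1:1] glued with the nodal cubic y² + xy = x³.) -/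
open MvPolynomial

/-- Every polynomial is of the form `a(s² - s) + b(s² - s) s`. -/
theorem Polynomial.exists_aeval_add_aeval_mul_X {R : Type*} [CommRing R] (f : Polynomial R) :
    ∃ a b : Polynomial R,
      f = Polynomial.aeval (Polynomial.X ^ 2 - Polynomial.X : Polynomial R) a
        + Polynomial.aeval (Polynomial.X ^ 2 - Polynomial.X : Polynomial R) b * Polynomial.X := by
  induction f using Polynomial.induction_on with
  | C r => exact ⟨Polynomial.C r, 0, by simp [Polynomial.algebraMap_eq]⟩
  | add p q hp hq =>
    obtain ⟨a, b, hab⟩ := hp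
    obtain ⟨c, d, hcd⟩ := hq
    refine ⟨a + c, b + d, ?_⟩
    rw [map_add, map_add, hab, hcd]
    ring
  | monomial n r h =>
    obtain ⟨a, b, hab⟩ := h
    refine ⟨Polynomial.X * b, a + b, ?_⟩
    rw [pow_succ, ← mul_assoc, hab, map_mul, map_add, Polynomial.aeval_X]
    ring

theorem Polynomial.eval_zero_aeval_X_sq_sub_X_add {R : Type*} [CommRing R] (a b : Polynomial R) :
    (Polynomial.aeval (Polynomial.X ^ 2 - Polynomial.X : Polynomial R) a
      + Polynomial.aeval (Polynomial.X ^ 2 - Polynomial.X : Polynomial R) b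
        * Polynomial.X).eval 0 = a.coeff 0 := by
  simp [← Polynomial.comp_eq_aeval, Polynomial.coeff_zero_eq_eval_zero]

theorem Polynomial.eval_one_aeval_X_sq_sub_X_add {R : Type*} [CommRing R] (a b : Polynomial R) :
    (Polynomial.aeval (Polynomial.X ^ 2 - Polynomial.X : Polynomial R) a
      + Polynomial.aeval (Polynomial.X ^ 2 - Polynomial.X : Polynomial R) b
        * Polynomial.X).eval 1 = a.coeff 0 + b.coeff 0 := by
  simp [← Polynomial.comp_eq_aeval, Polynomial.coeff_zero_eq_eval_zero]

/-- The elements `1` and `s` of `R[s]` are linearly independent over `R[s² - s]`. -/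
theorem Polynomial.eq_zero_of_aeval_add_aeval_mul_X_eq_zero {R : Type*} [CommRing R]
    {a b : Polynomial R}
    (h : Polynomial.aeval (Polynomial.X ^ 2 - Polynomial.X : Polynomial R) a
      + Polynomial.aeval (Polynomial.X ^ 2 - Polynomial.X : Polynomial R) b * Polynomial.X = 0) :
    a = 0 ∧ b = 0 := by
  have hm : (Polynomial.X ^ 2 - Polynomial.X : Polynomial R).Monic := by
    nontriviality R
    exact (Polynomial.monic_X_pow 2).sub_of_left (by simp)
  have coeff_zero {a b : Polynomial R}
      (h : Polynomial.aeval (Polynomial.X ^ 2 - Polynomial.X : Polynomial R) a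
        + Polynomial.aeval (Polynomial.X ^ 2 - Polynomial.X : Polynomial R) b * Polynomial.X = 0) :
      a.coeff 0 = 0 ∧ b.coeff 0 = 0 := by
    have h0 := Polynomial.eval_zero_aeval_X_sq_sub_X_add a b
    have h1 := Polynomial.eval_one_aeval_X_sq_sub_X_add a b
    rw [h, Polynomial.eval_zero] at h0 h1
    exact ⟨h0.symm, by rw [h1, ← h0, zero_add]⟩
  have key : ∀ (n : ℕ) (a b : Polynomial R),
      Polynomial.aeval (Polynomial.X ^ 2 - Polynomial.X : Polynomial R) a
        + Polynomial.aeval (Polynomial.X ^ 2 - Polynomial.X : Polynomial R) b * Polynomial.X = 0 →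
      a.coeff n = 0 ∧ b.coeff n = 0 := by
    intro n
    induction n with
    | zero => exact fun a b h => coeff_zero h
    | succ n ih =>
      intro a b h
      obtain ⟨ha, hb⟩ := coeff_zero h
      rw [← Polynomial.X_mul_divX_add a, ← Polynomial.X_mul_divX_add b, ha, hb] at h
      simp only [map_zero, add_zero, map_mul, Polynomial.aeval_X] at h
      rw [mul_assoc, ← mul_add] at h
      simpa only [Polynomial.coeff_divX] using
        ih a.divX b.divX ((hm.mul_right_eq_zero_iff).1 h)
  exact ⟨Polynomial.ext fun n => (key n a b h).1, Polynomial.ext fun n => (key n a b h).2⟩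

/-- Modulo `Y² + XY - X³`, every polynomial is congruent to one of the form `a(X) + b(X) Y`. -/
theorem MvPolynomial.exists_sub_mem_span_nodal_cubic {R : Type*} [CommRing R]
    (p : MvPolynomial (Fin 2) R) :
    ∃ a b : Polynomial R,
      p - (Polynomial.aeval (X 0 : MvPolynomial (Fin 2) R) a
          + Polynomial.aeval (X 0 : MvPolynomial (Fin 2) R) b * X 1)
        ∈ Ideal.span {(X 1 : MvPolynomial (Fin 2) R) ^ 2 + X 0 * X 1 - X 0 ^ 3} := by
  simp only [Ideal.mem_span_singleton']
  induction p using MvPolynomial.induction_on with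
  | C r => exact ⟨Polynomial.C r, 0, 0, by simp [MvPolynomial.algebraMap_eq]⟩
  | add p q hp hq =>
    obtain ⟨a, b, u, hu⟩ := hp
    obtain ⟨c, d, v, hv⟩ := hq
    refine ⟨a + c, b + d, u + v, ?_⟩
    simp only [map_add]
    linear_combination hu + hv
  | mul_X p i hp =>
    obtain ⟨a, b, u, hu⟩ := hp
    fin_cases i
    · refine ⟨Polynomial.X * a, Polynomial.X * b, u * X 0, ?_⟩
      simp only [map_mul, Polynomial.aeval_X, Fin.zero_eta]
      linear_combination X 0 * hu
    · refine ⟨Polynomial.X ^ 3 * b, a - Polynomial.X * b,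
        u * X 1 + Polynomial.aeval (X 0 : MvPolynomial (Fin 2) R) b, ?_⟩
      simp only [map_mul, map_sub, map_pow, Polynomial.aeval_X, Fin.mk_one]
      linear_combination X 1 * hu

/-- For the `R`-algebra homomorphism `π : R[X,Y] → R[s]`, `X ↦ s² − s`,
`Y ↦ s³ − 2s² + s`, the kernel is the ideal generated by `Y² + XY − X³`, and the range is
exactly the set of polynomials `f` with `f(0) = f(1)`. -/
theorem statement_12 (R : Type*) [CommRing R] :
    RingHom.ker (MvPolynomial.aeval
          ![(Polynomial.X : Polynomial R) ^ 2 - Polynomial.X,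
            (Polynomial.X : Polynomial R) ^ 3 - 2 * Polynomial.X ^ 2 + Polynomial.X] :
        MvPolynomial (Fin 2) R →ₐ[R] Polynomial R)
      = Ideal.span {(X 1 : MvPolynomial (Fin 2) R) ^ 2 + X 0 * X 1 - X 0 ^ 3} ∧
    ∀ f : Polynomial R,
      f ∈ (MvPolynomial.aeval
          ![(Polynomial.X : Polynomial R) ^ 2 - Polynomial.X,
            (Polynomial.X : Polynomial R) ^ 3 - 2 * Polynomial.X ^ 2 + Polynomial.X] :
        MvPolynomial (Fin 2) R →ₐ[R] Polynomial R).range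
      ↔ f.eval 0 = f.eval 1 := by
  set π : MvPolynomial (Fin 2) R →ₐ[R] Polynomial R := MvPolynomial.aeval
    ![(Polynomial.X : Polynomial R) ^ 2 - Polynomial.X,
      (Polynomial.X : Polynomial R) ^ 3 - 2 * Polynomial.X ^ 2 + Polynomial.X] with hπ
  have hX : π (X 0) = Polynomial.X ^ 2 - Polynomial.X := by simp [hπ]
  have hY : π (X 1) = Polynomial.X ^ 3 - 2 * Polynomial.X ^ 2 + Polynomial.X := by simp [hπ]
  have hπX (a : Polynomial R) : π (Polynomial.aeval (X 0) a)
      = Polynomial.aeval (Polynomial.X ^ 2 - Polynomial.X : Polynomial R) a := by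
    rw [← Polynomial.aeval_algHom_apply, hX]
  have hle : Ideal.span {(X 1 : MvPolynomial (Fin 2) R) ^ 2 + X 0 * X 1 - X 0 ^ 3}
      ≤ RingHom.ker π := by
    rw [Ideal.span_singleton_le_iff_mem, RingHom.mem_ker]
    simp only [map_add, map_sub, map_mul, map_pow, hX, hY]
    ring
  have hnormal (a b : Polynomial R) :
      π (Polynomial.aeval (X 0) a + Polynomial.aeval (X 0) b * X 1)
      = Polynomial.aeval (Polynomial.X ^ 2 - Polynomial.X : Polynomial R) (a - Polynomial.X * b)
        + Polynomial.aeval (Polynomial.X ^ 2 - Polynomial.X : Polynomial R) (Polynomial.X * b)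
          * Polynomial.X := by
    simp only [map_add, map_sub, map_mul, hπX, hY, Polynomial.aeval_X]
    ring
  refine ⟨le_antisymm (fun p hp => ?_) hle, fun f => ⟨?_, fun hf => ?_⟩⟩
  · obtain ⟨a, b, hab⟩ := MvPolynomial.exists_sub_mem_span_nodal_cubic p
    have h := hle hab
    rw [RingHom.mem_ker] at h hp
    rw [map_sub, hp, zero_sub, neg_eq_zero, hnormal] at h
    obtain ⟨ha, hb⟩ := Polynomial.eq_zero_of_aeval_add_aeval_mul_X_eq_zero h
    rw [hb, sub_zero] at ha
    rw [Polynomial.monic_X.mul_right_eq_zero_iff] at hb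
    simpa [ha, hb] using hab
  · rintro ⟨p, rfl⟩
    have h : (Polynomial.aeval (0 : R)).comp π = (Polynomial.aeval (1 : R)).comp π := by
      ext i
      fin_cases i
      · simp [hX]
      · simp [hY]; norm_num
    simpa [Polynomial.coe_aeval_eq_eval] using DFunLike.congr_fun h p
  · obtain ⟨a, b, rfl⟩ := Polynomial.exists_aeval_add_aeval_mul_X f
    rw [Polynomial.eval_zero_aeval_X_sq_sub_X_add, Polynomial.eval_one_aeval_X_sq_sub_X_add,
      left_eq_add] at hf
    have hb : Polynomial.X * b.divX = b := by simpa [hf] using b.X_mul_divX_add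
    exact ⟨Polynomial.aeval (X 0) (a + b) + Polynomial.aeval (X 0) b.divX * X 1,
      by simpa [hb] using hnormal (a + b) b.divX⟩
end

section
/- Let K be a field, let R = K[X,Y]/(Y² + XY − X³), and let f_X and f_Y denote the images in R of Y − 3X² and 2Y + X respectively. Let M be the R-submodule of R² consisting of all pairs (α,β) with α·f_X + β·f_Y = 0, and let N be the cyclic R-submodule of R² generated by (f_Y, −f_X). Then N is contained in M, and the quotient module M/N is a one-dimensional K-vector space. -/
open MvPolynomial

set_option synthInstance.maxHeartbeats 1000000
set_option maxHeartbeats 1000000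

/-- The coordinate ring `R = K[X,Y]/(Y² + XY − X³)` of the nodal cubic. -/
abbrev NodalRing (K : Type*) [Field K] : Type _ :=
  MvPolynomial (Fin 2) K ⧸
    Ideal.span ({X 1 ^ 2 + X 0 * X 1 - X 0 ^ 3} : Set (MvPolynomial (Fin 2) K))

/-- The image in `R` of `∂f/∂X = Y − 3X²` for `f = Y² + XY − X³`. -/
noncomputable def nodalfX (K : Type*) [Field K] : NodalRing K :=
  Ideal.Quotient.mk _ (X 1 - 3 * X 0 ^ 2)

/-- The image in `R` of `∂f/∂Y = 2Y + X` for `f = Y² + XY − X³`. -/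
noncomputable def nodalfY (K : Type*) [Field K] : NodalRing K :=
  Ideal.Quotient.mk _ (2 * X 1 + X 0)

/-- The parametrization `X ↦ t(t + 1)`, `Y ↦ t²(t + 1)` of the nodal cubic. -/
noncomputable def nodalParam (K : Type*) [Field K] : NodalRing K →ₐ[K] Polynomial K :=
  Ideal.Quotient.liftₐ _
    (aeval ![Polynomial.X * (Polynomial.X + 1), Polynomial.X ^ 2 * (Polynomial.X + 1)])
    (fun a ha => by
      have h : Ideal.span ({X 1 ^ 2 + X 0 * X 1 - X 0 ^ 3} : Set (MvPolynomial (Fin 2) K)) ≤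
          RingHom.ker (aeval (R := K) ![(Polynomial.X * (Polynomial.X + 1) : Polynomial K),
            Polynomial.X ^ 2 * (Polynomial.X + 1)]) := by
        rw [Ideal.span_singleton_le_iff_mem, RingHom.mem_ker]
        simp
        ring
      exact h ha)

/-- The image of `X` in the coordinate ring. -/
noncomputable def nodalX (K : Type*) [Field K] : NodalRing K := Ideal.Quotient.mk _ (X 0)

/-- The image of `Y` in the coordinate ring. -/
noncomputable def nodalY (K : Type*) [Field K] : NodalRing K := Ideal.Quotient.mk _ (X 1)

section NodalCubic

variable (K : Type*) [Field K]

theorem nodalfX_eq : nodalfX K = nodalY K - 3 * nodalX K ^ 2 := by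
  rfl

theorem nodalfY_eq : nodalfY K = 2 * nodalY K + nodalX K := by
  rfl

theorem nodalY_sq : nodalY K ^ 2 = nodalX K ^ 3 - nodalX K * nodalY K := by
  have h : (Ideal.Quotient.mk (Ideal.span
      ({X 1 ^ 2 + X 0 * X 1 - X 0 ^ 3} : Set (MvPolynomial (Fin 2) K))))
      (X 1 ^ 2 + X 0 * X 1 - X 0 ^ 3) = 0 :=
    Ideal.Quotient.eq_zero_iff_mem.2 (Ideal.mem_span_singleton_self _)
  simp only [map_sub, map_add, map_mul, map_pow] at h
  change nodalY K ^ 2 + nodalX K * nodalY K - nodalX K ^ 3 = 0 at h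
  linear_combination h

@[simp]
theorem nodalParam_nodalX :
    nodalParam K (nodalX K) = Polynomial.X * (Polynomial.X + 1) := by
  change aeval _ (X 0) = _
  simp

@[simp]
theorem nodalParam_nodalY :
    nodalParam K (nodalY K) = Polynomial.X ^ 2 * (Polynomial.X + 1) := by
  change aeval _ (X 1) = _
  simp

variable {K}

/-- `R` is generated by `1` and `Y` as a `K[X]`-module. -/
theorem exists_eq_aeval_add_aeval_mul_nodalY (r : NodalRing K) :
    ∃ a b : Polynomial K,
      r = Polynomial.aeval (nodalX K) a + Polynomial.aeval (nodalX K) b * nodalY K := by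
  obtain ⟨p, rfl⟩ := Ideal.Quotient.mk_surjective r
  induction p using MvPolynomial.induction_on with
  | C c =>
    refine ⟨Polynomial.C c, 0, ?_⟩
    simp only [Polynomial.aeval_C, map_zero, zero_mul, add_zero]
    rfl
  | add p q hp hq =>
    obtain ⟨a, b, h⟩ := hp
    obtain ⟨a', b', h'⟩ := hq
    refine ⟨a + a', b + b', ?_⟩
    rw [map_add, h, h', map_add, map_add]
    ring
  | mul_X p i hp =>
    obtain ⟨a, b, h⟩ := hp
    rw [map_mul, h]
    fin_cases i
    · refine ⟨a * Polynomial.X, b * Polynomial.X, ?_⟩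
      change _ * nodalX K = _
      simp only [map_mul, Polynomial.aeval_X]
      ring
    · refine ⟨b * Polynomial.X ^ 3, a - b * Polynomial.X, ?_⟩
      change _ * nodalY K = _
      simp only [map_mul, map_sub, map_pow, Polynomial.aeval_X]
      linear_combination (Polynomial.aeval (nodalX K) b) * nodalY_sq K

theorem nodalParam_aeval_nodalX (a : Polynomial K) :
    nodalParam K (Polynomial.aeval (nodalX K) a) =
      a.comp (Polynomial.X * (Polynomial.X + 1)) := by
  rw [← Polynomial.aeval_algHom_apply, nodalParam_nodalX, Polynomial.comp_eq_aeval]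

theorem nodalParam_injective : Function.Injective (nodalParam K) := by
  rw [injective_iff_map_eq_zero]
  intro r hr
  obtain ⟨a, b, rfl⟩ := exists_eq_aeval_add_aeval_mul_nodalY r
  rw [map_add, map_mul, nodalParam_aeval_nodalX, nodalParam_aeval_nodalX,
    nodalParam_nodalY] at hr
  have hX1 : (Polynomial.X + 1 : Polynomial K) ≠ 0 := Polynomial.X_add_C_ne_zero 1
  have hd1 : (Polynomial.X + 1 : Polynomial K).natDegree = 1 := Polynomial.natDegree_X_add_C 1
  have hq : (Polynomial.X * (Polynomial.X + 1) : Polynomial K).natDegree = 2 := by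
    rw [Polynomial.natDegree_mul Polynomial.X_ne_zero hX1, Polynomial.natDegree_X, hd1]
  have hs0 : (Polynomial.X ^ 2 * (Polynomial.X + 1) : Polynomial K) ≠ 0 :=
    mul_ne_zero (pow_ne_zero _ Polynomial.X_ne_zero) hX1
  have hs : (Polynomial.X ^ 2 * (Polynomial.X + 1) : Polynomial K).natDegree = 3 := by
    rw [Polynomial.natDegree_mul (pow_ne_zero _ Polynomial.X_ne_zero) hX1,
      Polynomial.natDegree_X_pow, hd1]
  have comp_zero : ∀ c : Polynomial K,
      c.comp (Polynomial.X * (Polynomial.X + 1)) = 0 → c = 0 := by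
    intro c hc
    rcases Polynomial.comp_eq_zero_iff.1 hc with h | ⟨-, h⟩
    · exact h
    · rw [h, Polynomial.natDegree_C] at hq
      omega
  have hb : b = 0 := by
    by_contra hb
    have hb' := fun h => hb (comp_zero b h)
    have h := congrArg Polynomial.natDegree (eq_neg_of_add_eq_zero_left hr)
    rw [Polynomial.natDegree_neg, Polynomial.natDegree_mul hb' hs0,
      Polynomial.natDegree_comp, Polynomial.natDegree_comp, hq, hs] at h
    omega
  subst hb
  have ha : a = 0 := comp_zero a (by simpa using hr)
  simp [ha]

theorem eval_zero_nodalParam (r : NodalRing K) :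
    (nodalParam K r).eval 0 = (nodalParam K r).eval (-1) := by
  obtain ⟨a, b, rfl⟩ := exists_eq_aeval_add_aeval_mul_nodalY r
  simp [nodalParam_aeval_nodalX, Polynomial.eval_comp]

/-- The normalization `K[t]` is spanned by the image of `R` and the single element `t`. -/
theorem exists_eq_nodalParam_add_C_mul_X (h : Polynomial K) :
    ∃ (r : NodalRing K) (c : K), h = nodalParam K r + Polynomial.C c * Polynomial.X := by
  have key : ∀ r : NodalRing K, ∃ (s : NodalRing K) (c : K),
      nodalParam K r * Polynomial.X = nodalParam K s + Polynomial.C c * Polynomial.X := by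
    intro r
    obtain ⟨a, b, rfl⟩ := exists_eq_aeval_add_aeval_mul_nodalY r
    refine ⟨Polynomial.aeval (nodalX K) a.divX * nodalY K +
      Polynomial.aeval (nodalX K) b * (nodalX K ^ 2 - nodalY K), a.coeff 0, ?_⟩
    have ha := congrArg (fun p => p.comp (Polynomial.X * (Polynomial.X + 1)))
      (Polynomial.divX_mul_X_add a)
    simp only [Polynomial.add_comp, Polynomial.mul_comp, Polynomial.X_comp,
      Polynomial.C_comp] at ha
    simp only [map_add, map_sub, map_mul, map_pow, nodalParam_aeval_nodalX,
      nodalParam_nodalX, nodalParam_nodalY]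
    linear_combination (-Polynomial.X) * ha
  induction h using Polynomial.induction_on' with
  | add p q hp hq =>
    obtain ⟨r, c, hp⟩ := hp
    obtain ⟨s, d, hq⟩ := hq
    refine ⟨r + s, c + d, ?_⟩
    rw [hp, hq, map_add, map_add]
    ring
  | monomial n a =>
    induction n with
    | zero => exact ⟨algebraMap K _ a, 0, by simp [AlgHom.commutes, Polynomial.algebraMap_eq]⟩
    | succ n ih =>
      obtain ⟨r, c, h⟩ := ih
      obtain ⟨s, d, hs⟩ := key r
      refine ⟨s + algebraMap K _ c * nodalX K, d - c, ?_⟩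
      rw [← Polynomial.monomial_mul_X, h, map_add, map_mul, AlgHom.commutes,
        nodalParam_nodalX, Polynomial.algebraMap_eq, map_sub]
      linear_combination hs

theorem nodalParam_nodalfX : nodalParam K (nodalfX K) =
    -(Polynomial.X * (Polynomial.X + 1) * (3 * Polynomial.X ^ 2 + 2 * Polynomial.X)) := by
  simp only [nodalfX_eq, map_sub, map_mul, map_pow, map_ofNat, nodalParam_nodalX,
    nodalParam_nodalY]
  ring

theorem nodalParam_nodalfY : nodalParam K (nodalfY K) =
    Polynomial.X * (Polynomial.X + 1) * (2 * Polynomial.X + 1) := by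
  simp only [nodalfY_eq, map_add, map_mul, map_ofNat, nodalParam_nodalX, nodalParam_nodalY]
  ring

/-- The element `t · (f_Y, -f_X)` of `R²`. -/
noncomputable def nodalSyzygy (K : Type*) [Field K] : NodalRing K × NodalRing K :=
  (2 * nodalX K ^ 2 - nodalY K, 3 * nodalX K * nodalY K - nodalX K ^ 2 + nodalY K)

theorem nodalParam_nodalSyzygy_fst : nodalParam K (nodalSyzygy K).1 =
    Polynomial.X * nodalParam K (nodalfY K) := by
  simp only [nodalSyzygy, nodalParam_nodalfY, map_sub, map_mul, map_pow, map_ofNat,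
    nodalParam_nodalX, nodalParam_nodalY]
  ring

theorem nodalParam_nodalSyzygy_snd : nodalParam K (nodalSyzygy K).2 =
    -(Polynomial.X * nodalParam K (nodalfX K)) := by
  simp only [nodalSyzygy, nodalParam_nodalfX, map_add, map_sub, map_mul, map_pow, map_ofNat,
    nodalParam_nodalX, nodalParam_nodalY]
  ring

theorem nodalSyzygy_mul_add :
    (nodalSyzygy K).1 * nodalfX K + (nodalSyzygy K).2 * nodalfY K = 0 := by
  apply nodalParam_injective
  rw [map_add, map_mul, map_mul, nodalParam_nodalSyzygy_fst, nodalParam_nodalSyzygy_snd,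
    map_zero]
  ring

theorem nodalSyzygy_ne_smul (r : NodalRing K) :
    r • ((nodalfY K, -nodalfX K) : NodalRing K × NodalRing K) ≠ nodalSyzygy K := by
  intro h
  have h1 := congrArg (fun p => nodalParam K p.1) h
  simp only [Prod.smul_fst, smul_eq_mul, map_mul, nodalParam_nodalSyzygy_fst] at h1
  have hne : nodalParam K (nodalfY K) ≠ 0 := by
    rw [nodalParam_nodalfY]
    refine mul_ne_zero (mul_ne_zero Polynomial.X_ne_zero (Polynomial.X_add_C_ne_zero 1)) ?_
    intro h0
    simpa using congrArg (Polynomial.eval 0) h0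
  have h2 := eval_zero_nodalParam r
  rw [mul_right_cancel₀ hne h1] at h2
  simp at h2

/-- Every syzygy of `(f_X, f_Y)` is an `R`-multiple of `(f_Y, -f_X)` plus a `K`-multiple of
`nodalSyzygy K`. -/
theorem exists_eq_smul_add_smul_nodalSyzygy {p : NodalRing K × NodalRing K}
    (hp : p.1 * nodalfX K + p.2 * nodalfY K = 0) :
    ∃ (r : NodalRing K) (c : K),
      p = r • ((nodalfY K, -nodalfX K) : NodalRing K × NodalRing K) + c • nodalSyzygy K := by
  obtain ⟨α, β⟩ := p
  have hX1 : (Polynomial.X + 1 : Polynomial K) ≠ 0 := Polynomial.X_add_C_ne_zero 1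
  have h := congrArg (nodalParam K) hp
  simp only [map_add, map_mul, map_zero, nodalParam_nodalfX, nodalParam_nodalfY] at h
  have hA0 := eval_zero_nodalParam α
  have hB0 := eval_zero_nodalParam β
  set A := nodalParam K α with hA
  set B := nodalParam K β with hB
  have hAB : A * (3 * Polynomial.X ^ 2 + 2 * Polynomial.X) = B * (2 * Polynomial.X + 1) := by
    apply mul_left_cancel₀ (mul_ne_zero Polynomial.X_ne_zero hX1)
    linear_combination -h
  obtain ⟨g, hg⟩ : ∃ g, g = (6 * Polynomial.X + 1) * A - 4 * B := ⟨_, rfl⟩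
  have hgA : A = g * (2 * Polynomial.X + 1) := by
    rw [hg]
    linear_combination (-4) * hAB
  have hgB : B = g * (3 * Polynomial.X ^ 2 + 2 * Polynomial.X) := by
    rw [hg]
    linear_combination (-(6 * Polynomial.X + 1)) * hAB
  rw [hgA] at hA0
  rw [hgB] at hB0
  simp only [Polynomial.eval_mul, Polynomial.eval_add, Polynomial.eval_pow, Polynomial.eval_X,
    Polynomial.eval_one, Polynomial.eval_ofNat] at hA0 hB0
  have hg1 : g.eval (-1) = 0 := by linear_combination -hB0
  have hg0 : g.eval 0 = 0 := by linear_combination hA0 - hg1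
  obtain ⟨k, rfl⟩ : Polynomial.X ∣ g := by
    rwa [Polynomial.X_dvd_iff, Polynomial.coeff_zero_eq_eval_zero]
  have hk : k.IsRoot (-1) := by simpa using hg1
  obtain ⟨l, rfl⟩ := Polynomial.dvd_iff_isRoot.2 hk
  obtain ⟨r, c, rfl⟩ := exists_eq_nodalParam_add_C_mul_X l
  simp only [map_neg, map_one, sub_neg_eq_add] at hgA hgB
  refine ⟨r, c, Prod.ext (nodalParam_injective ?_) (nodalParam_injective ?_)⟩
  · simp only [Prod.fst_add, Prod.smul_fst, smul_eq_mul, map_add, map_mul, map_smul,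
      nodalParam_nodalSyzygy_fst, nodalParam_nodalfY, Polynomial.smul_eq_C_mul]
    rw [← hA, hgA]
    ring
  · simp only [Prod.snd_add, Prod.smul_snd, smul_eq_mul, map_add, map_mul, map_smul, map_neg,
      nodalParam_nodalSyzygy_snd, nodalParam_nodalfX, Polynomial.smul_eq_C_mul]
    rw [← hB, hgB]
    ring

end NodalCubic

/-- For `R = K[X,Y]/(Y² + XY − X³)`, with `M = {(α,β) ∈ R² : α·f_X + β·f_Y = 0}` and
`N = R·(f_Y, −f_X)`, one has `N ⊆ M` and `M/N` is a one-dimensional `K`-vector space. -/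
theorem statement_15 (K : Type*) [Field K]
    (M N : Submodule (NodalRing K) (NodalRing K × NodalRing K))
    (hM : ∀ p : NodalRing K × NodalRing K, p ∈ M ↔ p.1 * nodalfX K + p.2 * nodalfY K = 0)
    (hN : N = Submodule.span (NodalRing K) {(nodalfY K, -(nodalfX K))}) :
    N ≤ M ∧
    Module.finrank K
      (↥(M.restrictScalars K) ⧸
        (N.restrictScalars K).comap (M.restrictScalars K).subtype) = 1 := by
  subst hN
  refine ⟨?_, ?_⟩
  · rw [Submodule.span_singleton_le_iff_mem, hM]
    ring
  · refine finrank_eq_one (Submodule.Quotient.mk ⟨nodalSyzygy K, (hM _).2 nodalSyzygy_mul_add⟩)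
      ?_ ?_
    · rw [Ne, Submodule.Quotient.mk_eq_zero]
      intro h
      obtain ⟨r, hr⟩ := Submodule.mem_span_singleton.1 h
      exact nodalSyzygy_ne_smul r hr
    · intro w
      obtain ⟨⟨p, hp⟩, rfl⟩ := Submodule.Quotient.mk_surjective _ w
      obtain ⟨r, c, h⟩ := exists_eq_smul_add_smul_nodalSyzygy ((hM p).1 hp)
      refine ⟨c, ?_⟩
      rw [← Submodule.Quotient.mk_smul, eq_comm, Submodule.Quotient.eq]
      refine Submodule.mem_span_singleton.2 ⟨r, ?_⟩
      change _ = p - c • nodalSyzygy K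
      rw [h, add_sub_cancel_right]
end

section
/- Let K be a field, let R = K[X,Y]/(Y² − X³), and let f_X and f_Y denote the images in R of −3X² and 2Y respectively. Let M be the R-submodule of R² consisting of all pairs (α,β) with α·f_X + β·f_Y = 0, and let N be the cyclic R-submodule of R² generated by (f_Y, −f_X). Then N is contained in M, the quotient M/N is a finite-dimensional K-vector space, and its dimension is 2 if the characteristic of K is neither 2 nor 3, is 3 if char K = 3, and is 4 if char K = 2. -/
open MvPolynomial

set_option synthInstance.maxHeartbeats 1000000
set_option maxHeartbeats 1000000

/-- The coordinate ring `R = K[X,Y]/(Y² − X³)` of the cuspidal cubic. -/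
abbrev CuspRing (K : Type*) [Field K] : Type _ :=
  MvPolynomial (Fin 2) K ⧸
    Ideal.span ({X 1 ^ 2 - X 0 ^ 3} : Set (MvPolynomial (Fin 2) K))

/-- The image in `R` of `∂f/∂X = −3X²` for `f = Y² − X³`. -/
noncomputable def cuspfX (K : Type*) [Field K] : CuspRing K :=
  Ideal.Quotient.mk _ (-(3 * X 0 ^ 2))

/-- The image in `R` of `∂f/∂Y = 2Y` for `f = Y² − X³`. -/
noncomputable def cuspfY (K : Type*) [Field K] : CuspRing K :=
  Ideal.Quotient.mk _ (2 * X 1)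

/-- The parametrization `X ↦ t²`, `Y ↦ t³` of the cuspidal cubic. -/
noncomputable def cuspParam (K : Type*) [Field K] : CuspRing K →ₐ[K] Polynomial K :=
  Ideal.Quotient.liftₐ _ (aeval ![Polynomial.X ^ 2, Polynomial.X ^ 3]) (by
    intro a ha
    rw [← RingHom.mem_ker]
    refine (Ideal.span_le.2 ?_) ha
    rintro _ rfl
    simp only [SetLike.mem_coe, RingHom.mem_ker]
    simp
    ring)

/-- The class of `X` in the cuspidal ring. -/
noncomputable def cuspX (K : Type*) [Field K] : CuspRing K := Ideal.Quotient.mk _ (X 0)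

/-- The class of `Y` in the cuspidal ring. -/
noncomputable def cuspY (K : Type*) [Field K] : CuspRing K := Ideal.Quotient.mk _ (X 1)

section

variable {K : Type*} [Field K]

lemma cuspParam_X : cuspParam K (cuspX K) = Polynomial.X ^ 2 := by
  change aeval ![Polynomial.X ^ 2, Polynomial.X ^ 3] (X 0 : MvPolynomial (Fin 2) K) = _
  simp

lemma cuspParam_Y : cuspParam K (cuspY K) = Polynomial.X ^ 3 := by
  change aeval ![Polynomial.X ^ 2, Polynomial.X ^ 3] (X 1 : MvPolynomial (Fin 2) K) = _
  simp

lemma cuspY_sq : cuspY K ^ 2 = cuspX K ^ 3 := by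
  rw [cuspX, cuspY, ← map_pow, ← map_pow, Ideal.Quotient.eq]
  exact Ideal.subset_span rfl

lemma cuspfX_eq : cuspfX K = -(3 * cuspX K ^ 2) := rfl

lemma cuspfY_eq : cuspfY K = 2 * cuspY K := rfl

lemma cuspRing_normal_form (r : CuspRing K) : ∃ a b : Polynomial K,
    r = Polynomial.aeval (cuspX K) a + Polynomial.aeval (cuspX K) b * cuspY K := by
  obtain ⟨p, rfl⟩ := Ideal.Quotient.mk_surjective r
  induction p using MvPolynomial.induction_on with
  | C c =>
    refine ⟨Polynomial.C c, 0, ?_⟩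
    simp
    rfl
  | add p q hp hq =>
    obtain ⟨a, b, h⟩ := hp
    obtain ⟨a', b', h'⟩ := hq
    refine ⟨a + a', b + b', ?_⟩
    rw [map_add, h, h']
    simp only [map_add]
    ring
  | mul_X p i hp =>
    obtain ⟨a, b, h⟩ := hp
    rw [map_mul, h]
    fin_cases i
    · refine ⟨a * Polynomial.X, b * Polynomial.X, ?_⟩
      change _ * cuspX K = _
      simp only [map_mul, Polynomial.aeval_X]
      ring
    · refine ⟨b * Polynomial.X ^ 3, a, ?_⟩
      change _ * cuspY K = _
      simp only [map_mul, map_pow, Polynomial.aeval_X]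
      linear_combination (Polynomial.aeval (cuspX K) b) * cuspY_sq (K := K)

lemma cuspParam_aeval_X (a : Polynomial K) :
    cuspParam K (Polynomial.aeval (cuspX K) a) = Polynomial.expand K 2 a := by
  rw [← Polynomial.aeval_algHom_apply, cuspParam_X, Polynomial.expand_eq_comp_X_pow,
    Polynomial.comp_eq_aeval]

lemma cuspParam_injective : Function.Injective (cuspParam K) := by
  rw [injective_iff_map_eq_zero]
  intro r hr
  obtain ⟨a, b, rfl⟩ := cuspRing_normal_form r
  rw [map_add, map_mul, cuspParam_aeval_X, cuspParam_aeval_X, cuspParam_Y] at hr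
  have ha : a = 0 := by
    ext n
    have h := congrArg (fun p => Polynomial.coeff p (n * 2)) hr
    simp only [Polynomial.coeff_add, Polynomial.coeff_expand_mul two_pos,
      Polynomial.coeff_mul_X_pow', Polynomial.coeff_expand two_pos, Polynomial.coeff_zero] at h
    have h2 : ¬ (3 ≤ n * 2 ∧ 2 ∣ n * 2 - 3) := by omega
    by_cases h3 : 3 ≤ n * 2
    · rw [if_pos h3, if_neg (fun h4 => h2 ⟨h3, h4⟩)] at h
      simpa using h
    · rw [if_neg h3] at h
      simpa using h
  have hb : b = 0 := by
    rw [ha, map_zero, zero_add] at hr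
    have h := (mul_eq_zero.1 hr).resolve_right (pow_ne_zero _ Polynomial.X_ne_zero)
    exact (Polynomial.expand_eq_zero two_pos).1 h
  simp [ha, hb]

lemma coeff_one_cuspParam (r : CuspRing K) : (cuspParam K r).coeff 1 = 0 := by
  obtain ⟨a, b, rfl⟩ := cuspRing_normal_form r
  rw [map_add, map_mul, cuspParam_aeval_X, cuspParam_aeval_X, cuspParam_Y]
  simp [Polynomial.coeff_expand two_pos, Polynomial.coeff_mul_X_pow']

lemma exists_cuspParam_eq {p : Polynomial K} (hp : p.coeff 1 = 0) :
    ∃ r, cuspParam K r = p := by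
  change p ∈ (cuspParam K).range
  rw [p.as_sum_support_C_mul_X_pow]
  refine sum_mem fun i hi => ?_
  have hi1 : i ≠ 1 := by
    rintro rfl
    exact Polynomial.mem_support_iff.1 hi hp
  refine mul_mem ((cuspParam K).range.algebraMap_mem _) ?_
  obtain ⟨k, rfl | rfl⟩ : ∃ k, i = 2 * k ∨ i = 2 * k + 3 := by
    rcases Nat.even_or_odd' i with ⟨k, h | h⟩
    · exact ⟨k, Or.inl h⟩
    · exact ⟨k - 1, Or.inr (by omega)⟩
  · exact ⟨cuspX K ^ k, by simp [cuspParam_X, pow_mul]⟩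
  · exact ⟨cuspX K ^ k * cuspY K, by simp [cuspParam_X, cuspParam_Y, pow_mul, pow_add]⟩

/-- A multiple of `t ^ d` whose cofactor has no linear term comes from the cuspidal ring. -/
lemma exists_eq_mul_of_coeff {s r : CuspRing K} {d : ℕ} (hs : cuspParam K s = Polynomial.X ^ d)
    (h : ∀ i < d, (cuspParam K r).coeff i = 0) (hd : (cuspParam K r).coeff (d + 1) = 0) :
    ∃ q, r = s * q := by
  obtain ⟨p, hp⟩ := Polynomial.X_pow_dvd_iff.2 h
  have hp1 : p.coeff 1 = 0 := by
    rw [hp, add_comm, Polynomial.coeff_X_pow_mul] at hd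
    exact hd
  obtain ⟨q, rfl⟩ := exists_cuspParam_eq hp1
  exact ⟨q, cuspParam_injective (by rw [hp, map_mul, hs])⟩

lemma exists_eq_cuspY_mul {r : CuspRing K} (h0 : (cuspParam K r).coeff 0 = 0)
    (h2 : (cuspParam K r).coeff 2 = 0) (h4 : (cuspParam K r).coeff 4 = 0) :
    ∃ q, r = cuspY K * q := by
  refine exists_eq_mul_of_coeff cuspParam_Y (fun i hi => ?_) h4
  interval_cases i
  exacts [h0, coeff_one_cuspParam r, h2]

lemma exists_eq_cuspX_sq_mul {r : CuspRing K} (h0 : (cuspParam K r).coeff 0 = 0)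
    (h2 : (cuspParam K r).coeff 2 = 0) (h3 : (cuspParam K r).coeff 3 = 0)
    (h5 : (cuspParam K r).coeff 5 = 0) :
    ∃ q, r = cuspX K ^ 2 * q := by
  refine exists_eq_mul_of_coeff (d := 4) (by rw [map_pow, cuspParam_X]; ring)
    (fun i hi => ?_) h5
  interval_cases i
  exacts [h0, coeff_one_cuspParam r, h2, h3]

instance : IsDomain (CuspRing K) :=
  cuspParam_injective.isDomain (cuspParam K).toRingHom

lemma cuspX_ne_zero : cuspX K ≠ 0 := by
  intro h
  have h1 := cuspParam_X (K := K)
  rw [h, map_zero] at h1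
  exact pow_ne_zero _ Polynomial.X_ne_zero h1.symm

lemma cuspY_ne_zero : cuspY K ≠ 0 := by
  intro h
  have h1 := cuspParam_Y (K := K)
  rw [h, map_zero] at h1
  exact pow_ne_zero _ Polynomial.X_ne_zero h1.symm

/-- The coefficients with indices `e` of the parametrized elements. -/
noncomputable def cuspCoeffs {n : ℕ} (e : Fin n → ℕ) : CuspRing K →ₗ[K] (Fin n → K) :=
  LinearMap.pi fun i => Polynomial.lcoeff K (e i) ∘ₗ (cuspParam K).toLinearMap

lemma cuspCoeffs_apply {n : ℕ} (e : Fin n → ℕ) (r : CuspRing K) (i : Fin n) :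
    cuspCoeffs e r i = (cuspParam K r).coeff (e i) := rfl

lemma finrank_quotient_comap_subtype {V : Type*} [AddCommGroup V] [Module K V] {n : ℕ}
    (M N : Submodule K V) (L : V →ₗ[K] (Fin n → K))
    (hsurj : ∀ c, ∃ v ∈ M, L v = c) (hker : ∀ v ∈ M, L v = 0 ↔ v ∈ N) :
    FiniteDimensional K (M ⧸ N.comap M.subtype) ∧
      Module.finrank K (M ⧸ N.comap M.subtype) = n := by
  have hk : N.comap M.subtype = LinearMap.ker (L ∘ₗ M.subtype) := by
    ext ⟨v, hv⟩
    simp [hker v hv]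
  have hs : Function.Surjective (L ∘ₗ M.subtype) := fun c => by
    obtain ⟨v, hv, h⟩ := hsurj c
    exact ⟨⟨v, hv⟩, h⟩
  rw [hk]
  let E := (L ∘ₗ M.subtype).quotKerEquivOfSurjective hs
  exact ⟨E.symm.finiteDimensional, by rw [E.finrank_eq, Module.finrank_fin_fun]⟩

lemma cusp_finrank_syzygies_of_ne (h2 : (2 : K) ≠ 0) (h3 : (3 : K) ≠ 0)
    (M N : Submodule (CuspRing K) (CuspRing K × CuspRing K))
    (hM : ∀ p : CuspRing K × CuspRing K, p ∈ M ↔ p.1 * cuspfX K + p.2 * cuspfY K = 0)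
    (hN : N = Submodule.span (CuspRing K) {(cuspfY K, -(cuspfX K))}) :
    FiniteDimensional K
      (↥(M.restrictScalars K) ⧸
        (N.restrictScalars K).comap (M.restrictScalars K).subtype) ∧
    Module.finrank K
      (↥(M.restrictScalars K) ⧸
        (N.restrictScalars K).comap (M.restrictScalars K).subtype) = 2 := by
  obtain ⟨u, hu⟩ : ∃ u : CuspRing K, 2 * u = 1 := by
    refine ⟨algebraMap K _ 2⁻¹, ?_⟩
    rw [← map_ofNat (algebraMap K (CuspRing K)) 2, ← map_mul, mul_inv_cancel₀ h2, map_one]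
  have h2' : (2 : CuspRing K) ≠ 0 := left_ne_zero_of_mul_eq_one hu
  refine finrank_quotient_comap_subtype _ _
    (cuspCoeffs ![2, 4] ∘ₗ LinearMap.fst K (CuspRing K) (CuspRing K)) ?_ ?_
  · intro c
    refine ⟨c 0 • (cuspX K, 3 * u * cuspY K) + c 1 • (cuspX K ^ 2, 3 * u * cuspX K * cuspY K),
      ?_, ?_⟩
    · refine add_mem (Submodule.smul_mem _ _ ?_) (Submodule.smul_mem _ _ ?_) <;>
      · rw [Submodule.restrictScalars_mem, hM, cuspfX_eq, cuspfY_eq]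
        first
        | linear_combination 3 * cuspY K ^ 2 * hu + 3 * cuspY_sq (K := K)
        | linear_combination 3 * cuspX K * cuspY K ^ 2 * hu + 3 * cuspX K * cuspY_sq (K := K)
    · ext i
      fin_cases i <;>
        simp [cuspCoeffs_apply, cuspParam_X, ← pow_mul, Polynomial.coeff_X_pow]
  · rintro ⟨a, b⟩ hab
    rw [Submodule.restrictScalars_mem, hM, cuspfX_eq, cuspfY_eq] at hab
    rw [Submodule.restrictScalars_mem, hN, Submodule.mem_span_singleton, cuspfX_eq, cuspfY_eq]
    constructor
    · intro h
      have e2 : (cuspParam K a).coeff 2 = 0 := congrFun h 0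
      have e4 : (cuspParam K a).coeff 4 = 0 := congrFun h 1
      have e0 : (cuspParam K a).coeff 0 = 0 := by
        have h' := congrArg (fun r => (cuspParam K r).coeff 4) hab
        have hb := coeff_one_cuspParam b
        have e : cuspParam K (a * -(3 * cuspX K ^ 2) + b * (2 * cuspY K)) =
            Polynomial.C (-3) * (cuspParam K a * Polynomial.X ^ 4) +
            Polynomial.C 2 * (cuspParam K b * Polynomial.X ^ 3) := by
          simp only [map_add, map_mul, map_neg, map_pow, cuspParam_X, cuspParam_Y, map_ofNat]
          ring
        simp only [e, Polynomial.coeff_add, Polynomial.coeff_C_mul, Polynomial.coeff_mul_X_pow',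
          map_zero, Polynomial.coeff_zero] at h'
        simpa [hb, h3] using h'
      obtain ⟨q, rfl⟩ := exists_eq_cuspY_mul e0 e2 e4
      refine ⟨u * q, Prod.ext ?_ ?_⟩
      · simp only [Prod.smul_mk, smul_eq_mul]
        linear_combination q * cuspY K * hu
      · simp only [Prod.smul_mk, smul_eq_mul]
        apply mul_left_cancel₀ (mul_ne_zero h2' (cuspY_ne_zero (K := K)))
        linear_combination -hab + 3 * cuspX K ^ 2 * cuspY K * q * hu
    · rintro ⟨q, hq⟩
      obtain ⟨rfl, rfl⟩ := Prod.mk.inj hq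
      have hq1 := coeff_one_cuspParam q
      have e : cuspParam K (q * (2 * cuspY K)) =
          Polynomial.C 2 * (cuspParam K q * Polynomial.X ^ 3) := by
        simp only [map_mul, cuspParam_Y, map_ofNat]
        ring
      ext i
      fin_cases i <;>
        simp [cuspCoeffs_apply, -map_mul, e, Polynomial.coeff_mul_X_pow', hq1]

lemma cusp_finrank_syzygies_of_three_eq_zero (h2 : (2 : K) ≠ 0) (h3 : (3 : K) = 0)
    (M N : Submodule (CuspRing K) (CuspRing K × CuspRing K))
    (hM : ∀ p : CuspRing K × CuspRing K, p ∈ M ↔ p.1 * cuspfX K + p.2 * cuspfY K = 0)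
    (hN : N = Submodule.span (CuspRing K) {(cuspfY K, -(cuspfX K))}) :
    FiniteDimensional K
      (↥(M.restrictScalars K) ⧸
        (N.restrictScalars K).comap (M.restrictScalars K).subtype) ∧
    Module.finrank K
      (↥(M.restrictScalars K) ⧸
        (N.restrictScalars K).comap (M.restrictScalars K).subtype) = 3 := by
  obtain ⟨u, hu⟩ : ∃ u : CuspRing K, 2 * u = 1 := by
    refine ⟨algebraMap K _ 2⁻¹, ?_⟩
    rw [← map_ofNat (algebraMap K (CuspRing K)) 2, ← map_mul, mul_inv_cancel₀ h2, map_one]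
  have h2' : (2 : CuspRing K) ≠ 0 := left_ne_zero_of_mul_eq_one hu
  have h3' : (3 : CuspRing K) = 0 := by
    rw [← map_ofNat (algebraMap K (CuspRing K)) 3, h3, map_zero]
  refine finrank_quotient_comap_subtype _ _
    (cuspCoeffs ![0, 2, 4] ∘ₗ LinearMap.fst K (CuspRing K) (CuspRing K)) ?_ ?_
  · intro c
    refine ⟨(c 0 • 1 + c 1 • cuspX K + c 2 • cuspX K ^ 2, 0), ?_, ?_⟩
    · rw [Submodule.restrictScalars_mem, hM, cuspfX_eq, h3']
      simp
    · ext i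
      fin_cases i <;>
        simp [cuspCoeffs_apply, cuspParam_X, ← pow_mul, Polynomial.coeff_X_pow,
          Polynomial.coeff_one]
  · rintro ⟨a, b⟩ hab
    rw [Submodule.restrictScalars_mem, hM, cuspfX_eq, cuspfY_eq, h3'] at hab
    rw [Submodule.restrictScalars_mem, hN, Submodule.mem_span_singleton, cuspfX_eq, cuspfY_eq, h3']
    have hb : b = 0 := by simpa [h2', cuspY_ne_zero] using hab
    constructor
    · intro h
      obtain ⟨q, rfl⟩ := exists_eq_cuspY_mul (r := a) (congrFun h 0) (congrFun h 1) (congrFun h 2)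
      refine ⟨u * q, Prod.ext ?_ ?_⟩
      · simp only [Prod.smul_mk, smul_eq_mul]
        linear_combination q * cuspY K * hu
      · simp [hb]
    · rintro ⟨q, hq⟩
      obtain ⟨rfl, -⟩ := Prod.mk.inj hq
      have hq1 := coeff_one_cuspParam q
      have e : cuspParam K (q * (2 * cuspY K)) =
          Polynomial.C 2 * (cuspParam K q * Polynomial.X ^ 3) := by
        simp only [map_mul, cuspParam_Y, map_ofNat]
        ring
      ext i
      fin_cases i <;>
        simp [cuspCoeffs_apply, -map_mul, e, Polynomial.coeff_mul_X_pow', hq1]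

lemma cusp_finrank_syzygies_of_two_eq_zero (h2 : (2 : K) = 0)
    (M N : Submodule (CuspRing K) (CuspRing K × CuspRing K))
    (hM : ∀ p : CuspRing K × CuspRing K, p ∈ M ↔ p.1 * cuspfX K + p.2 * cuspfY K = 0)
    (hN : N = Submodule.span (CuspRing K) {(cuspfY K, -(cuspfX K))}) :
    FiniteDimensional K
      (↥(M.restrictScalars K) ⧸
        (N.restrictScalars K).comap (M.restrictScalars K).subtype) ∧
    Module.finrank K
      (↥(M.restrictScalars K) ⧸
        (N.restrictScalars K).comap (M.restrictScalars K).subtype) = 4 := by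
  have h2' : (2 : CuspRing K) = 0 := by
    rw [← map_ofNat (algebraMap K (CuspRing K)) 2, h2, map_zero]
  have h3' : (3 : CuspRing K) = 1 := by linear_combination h2'
  refine finrank_quotient_comap_subtype _ _
    (cuspCoeffs ![0, 2, 3, 5] ∘ₗ LinearMap.snd K (CuspRing K) (CuspRing K)) ?_ ?_
  · intro c
    refine ⟨(0, c 0 • 1 + c 1 • cuspX K + c 2 • cuspY K + c 3 • (cuspX K * cuspY K)), ?_, ?_⟩
    · rw [Submodule.restrictScalars_mem, hM, cuspfY_eq, h2']
      simp
    · ext i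
      fin_cases i <;>
        simp [cuspCoeffs_apply, cuspParam_X, cuspParam_Y, ← pow_add, Polynomial.coeff_X_pow,
          Polynomial.coeff_one]
  · rintro ⟨a, b⟩ hab
    rw [Submodule.restrictScalars_mem, hM, cuspfX_eq, cuspfY_eq, h2', h3'] at hab
    rw [Submodule.restrictScalars_mem, hN, Submodule.mem_span_singleton, cuspfX_eq, cuspfY_eq,
      h2', h3']
    have ha : a = 0 := by simpa [cuspX_ne_zero] using hab
    constructor
    · intro h
      obtain ⟨q, rfl⟩ := exists_eq_cuspX_sq_mul (r := b) (congrFun h 0) (congrFun h 1)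
        (congrFun h 2) (congrFun h 3)
      refine ⟨q, Prod.ext ?_ ?_⟩
      · simp [ha]
      · simp [mul_comm]
    · rintro ⟨q, hq⟩
      obtain ⟨-, rfl⟩ := Prod.mk.inj hq
      have hq1 := coeff_one_cuspParam q
      have e : cuspParam K (q * - -(1 * cuspX K ^ 2)) =
          cuspParam K q * Polynomial.X ^ 4 := by
        simp only [neg_neg, one_mul, map_mul, map_pow, cuspParam_X, ← pow_mul]
      ext i
      fin_cases i <;>
        simp [cuspCoeffs_apply, -map_mul, -neg_neg, -one_mul, e, Polynomial.coeff_mul_X_pow', hq1]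

end

/-- For `R = K[X,Y]/(Y² − X³)`, with `M = {(α,β) ∈ R² : α·f_X + β·f_Y = 0}` and
`N = R·(f_Y, −f_X)`, one has `N ⊆ M`, the quotient `M/N` is a finite-dimensional
`K`-vector space, and its dimension is `2` if `char K ∉ {2,3}`, `3` if `char K = 3`, and
`4` if `char K = 2`. -/
theorem statement_16 (K : Type*) [Field K]
    (M N : Submodule (CuspRing K) (CuspRing K × CuspRing K))
    (hM : ∀ p : CuspRing K × CuspRing K, p ∈ M ↔ p.1 * cuspfX K + p.2 * cuspfY K = 0)
    (hN : N = Submodule.span (CuspRing K) {(cuspfY K, -(cuspfX K))}) :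
    N ≤ M ∧
    FiniteDimensional K
      (↥(M.restrictScalars K) ⧸
        (N.restrictScalars K).comap (M.restrictScalars K).subtype) ∧
    ((ringChar K ≠ 2 ∧ ringChar K ≠ 3) →
      Module.finrank K
        (↥(M.restrictScalars K) ⧸
          (N.restrictScalars K).comap (M.restrictScalars K).subtype) = 2) ∧
    (ringChar K = 3 →
      Module.finrank K
        (↥(M.restrictScalars K) ⧸
          (N.restrictScalars K).comap (M.restrictScalars K).subtype) = 3) ∧
    (ringChar K = 2 →
      Module.finrank K
        (↥(M.restrictScalars K) ⧸
          (N.restrictScalars K).comap (M.restrictScalars K).subtype) = 4) := by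
  have hchar : ∀ p : ℕ, p.Prime → ((p : K) = 0 ↔ ringChar K = p) := by
    intro p hp
    rw [ringChar.spec]
    constructor
    · intro h
      exact ((Nat.dvd_prime hp).1 h).resolve_left (CharP.ringChar_ne_one)
    · rintro rfl
      exact dvd_rfl
  have c2 : (2 : K) = 0 ↔ ringChar K = 2 := by exact_mod_cast hchar 2 Nat.prime_two
  have c3 : (3 : K) = 0 ↔ ringChar K = 3 := by exact_mod_cast hchar 3 Nat.prime_three
  refine ⟨?_, ?_, fun h => ?_, fun h => ?_, fun h => ?_⟩
  · rw [hN, Submodule.span_singleton_le_iff_mem, hM]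
    ring
  · by_cases h2 : (2 : K) = 0
    · exact (cusp_finrank_syzygies_of_two_eq_zero h2 M N hM hN).1
    by_cases h3 : (3 : K) = 0
    · exact (cusp_finrank_syzygies_of_three_eq_zero h2 h3 M N hM hN).1
    · exact (cusp_finrank_syzygies_of_ne h2 h3 M N hM hN).1
  · exact (cusp_finrank_syzygies_of_ne (mt c2.1 h.1) (mt c3.1 h.2) M N hM hN).2
  · exact (cusp_finrank_syzygies_of_three_eq_zero (fun h2 => by have := c2.1 h2; omega) (c3.2 h)
      M N hM hN).2
  · exact (cusp_finrank_syzygies_of_two_eq_zero (c2.2 h) M N hM hN).2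
end

section
/- Let R = ℤ[X,Y]/(XY). Every finitely generated projective R-module is stably free: for every finitely generated projective R-module P there exist natural numbers n and m and an R-module isomorphism P ⊕ Rⁿ ≅ Rᵐ. -/
open MvPolynomial

set_option synthInstance.maxHeartbeats 1000000
set_option maxHeartbeats 1000000

/-- The coordinate ring `R = ℤ[X,Y]/(XY)` of the node over `ℤ`. -/
abbrev NodeRing : Type _ :=
  MvPolynomial (Fin 2) ℤ ⧸
    Ideal.span ({X 0 * X 1} : Set (MvPolynomial (Fin 2) ℤ))

namespace PolynomialModule
open Polynomial

theorem coeff_sub {A M : Type*} [CommRing A] [AddCommGroup M] [Module A M]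
    (x y : PolynomialModule A M) : (x - y).coeff = x.coeff - y.coeff :=
  map_sub coeffAddEquiv x y

theorem exists_coeff_eq_zero {A M : Type*} [CommRing A] [AddCommGroup M] [Module A M]
    (x : PolynomialModule A M) : ∃ k, ∀ i, k ≤ i → x.coeff i = 0 := by
  refine ⟨x.coeff.support.sup id + 1, fun i hi ↦ ?_⟩
  by_contra h
  have := Finset.le_sup (f := id) (Finsupp.mem_support_iff.2 h)
  simp only [id] at this
  omega

section Lift
variable {A M Q : Type*} [CommRing A] [AddCommGroup M] [Module A M] [AddCommGroup Q] [Module A Q]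
  [Module A[X] Q] [IsScalarTower A A[X] Q]

/-- The `A[X]`-linear map `M[X] → Q` extending an `A`-linear map `M → Q`. -/
noncomputable def lift (l : M →ₗ[A] Q) : PolynomialModule A M →ₗ[A[X]] Q :=
  l.liftBaseChange A[X] ∘ₗ (polynomialTensorProductLEquivPolynomialModule A M).symm.toLinearMap

theorem lift_single (l : M →ₗ[A] Q) (i : ℕ) (m : M) :
    lift l (single A i m) = (X : A[X]) ^ i • l m := by
  have h : (polynomialTensorProductLEquivPolynomialModule A M).symm (single A i m) =
      ((X : A[X]) ^ i) ⊗ₜ m := by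
    rw [LinearEquiv.symm_apply_eq]
    simp [polynomialTensorProductLEquivPolynomialModule, ← monomial_one_right_eq_X_pow, lsingle]
  simp [lift, h]

theorem lift_eq_sum (l : M →ₗ[A] Q) (x : PolynomialModule A M) {k : ℕ}
    (hx : ∀ i, k ≤ i → x.coeff i = 0) :
    lift l x = ∑ i ∈ Finset.range k, (X : A[X]) ^ i • l (x.coeff i) := by
  have h : ∀ x : PolynomialModule A M,
      lift l x = x.coeff.sum fun i m ↦ (X : A[X]) ^ i • l m := by
    intro x
    induction x using PolynomialModule.induction_linear with
    | zero => simp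
    | add x y hx hy =>
      rw [map_add, hx, hy, coeff_add, Finsupp.sum_add_index'] <;> simp
    | single i m => rw [lift_single, coeff_single, Finsupp.sum_single_index (by simp)]
  rw [h, Finsupp.sum_of_support_subset]
  · intro i hi
    by_contra hk
    exact Finsupp.mem_support_iff.1 hi (hx i (by simpa using hk))
  · simp

end Lift

section Filtration
variable {A : Type*} [CommRing A] {n : ℕ} (N : Submodule A[X] (Fin n → A[X]))

/-- The vectors of a submodule `N` of `A[X]ⁿ` all of whose entries have degree `< d`. -/
noncomputable def degreeFiltration (d : ℕ) : Submodule A (Fin n → A[X]) :=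
  N.restrictScalars A ⊓ Submodule.pi Set.univ fun _ ↦ degreeLT A d

variable {N}

theorem mem_degreeFiltration {d : ℕ} {v : Fin n → A[X]} :
    v ∈ degreeFiltration N d ↔ v ∈ N ∧ ∀ i j, d ≤ j → (v i).coeff j = 0 := by
  simp [degreeFiltration, Submodule.mem_pi, mem_degreeLT, degree_lt_iff_coeff_zero]

theorem degreeFiltration_mono {d e : ℕ} (h : d ≤ e) :
    degreeFiltration N d ≤ degreeFiltration N e := fun v hv ↦ by
  rw [mem_degreeFiltration] at hv ⊢
  exact ⟨hv.1, fun i j hj ↦ hv.2 i j (h.trans hj)⟩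

theorem X_smul_mem_degreeFiltration {d : ℕ} {v : Fin n → A[X]} (hv : v ∈ degreeFiltration N d) :
    (X : A[X]) • v ∈ degreeFiltration N (d + 1) := by
  rw [mem_degreeFiltration] at hv ⊢
  refine ⟨N.smul_mem _ hv.1, fun i j hj ↦ ?_⟩
  obtain ⟨j, rfl⟩ := Nat.exists_eq_add_of_le' (show 1 ≤ j by omega)
  simpa using hv.2 i j (by omega)

theorem exists_mem_degreeFiltration {v : Fin n → A[X]} (hv : v ∈ N) :
    ∃ d, v ∈ degreeFiltration N d := by
  refine ⟨Finset.univ.sup fun i ↦ (v i).natDegree + 1, mem_degreeFiltration.2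
    ⟨hv, fun i j hj ↦ coeff_eq_zero_of_natDegree_lt ?_⟩⟩
  have := Finset.le_sup (f := fun i ↦ (v i).natDegree + 1) (Finset.mem_univ i)
  omega

instance [IsNoetherianRing A] (d : ℕ) : Module.Finite A (degreeFiltration N d) := by
  have : Module.Finite A (degreeLT A d) := Module.Finite.equiv (degreeLTEquiv A d).symm
  have : IsNoetherian A (Fin n → degreeLT A d) := inferInstance
  let f : degreeFiltration N d →ₗ[A] (Fin n → degreeLT A d) :=
    LinearMap.pi fun i ↦ ((LinearMap.proj i).comp (degreeFiltration N d).subtype).codRestrict _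
      fun v ↦ (Submodule.mem_pi.1 v.2.2) i trivial
  refine Module.Finite.of_injective f fun v w h ↦ ?_
  ext1
  funext i
  exact congrArg Subtype.val (congrFun h i)

variable (N) in
/-- Multiplication by `X` as a map between consecutive steps of the degree filtration. -/
noncomputable def mulX (d : ℕ) : degreeFiltration N d →ₗ[A] degreeFiltration N (d + 1) :=
  (((LinearMap.lsmul A[X] (Fin n → A[X]) X).restrictScalars A).comp
    (degreeFiltration N d).subtype).codRestrict _ fun v ↦ X_smul_mem_degreeFiltration v.2

theorem coe_mulX {d : ℕ} (v : degreeFiltration N d) :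
    (mulX N d v : Fin n → A[X]) = (X : A[X]) • (v : Fin n → A[X]) := rfl

variable (N) in
/-- The map `v ↦ X ⊗ v - 1 ⊗ Xv` from `N_d[X]` to `N_{d+1}[X]`. -/
noncomputable def charMap (d : ℕ) : PolynomialModule A (degreeFiltration N d) →ₗ[A[X]]
    PolynomialModule A (degreeFiltration N (d + 1)) :=
  lift (lsingle A 1 ∘ₗ Submodule.inclusion (degreeFiltration_mono d.le_succ) -
    lsingle A 0 ∘ₗ mulX N d)

theorem charMap_single {d : ℕ} (i : ℕ) (v : degreeFiltration N d) :
    charMap N d (single A i v) =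
      single A (i + 1) (Submodule.inclusion (degreeFiltration_mono d.le_succ) v) -
        single A i (mulX N d v) := by
  rw [charMap, lift_single]
  simp [smul_sub, lsingle, ← monomial_one_right_eq_X_pow, monomial_smul_single]

theorem charMap_coeff_succ {d : ℕ} (x : PolynomialModule A (degreeFiltration N d)) (i : ℕ) :
    (charMap N d x).coeff (i + 1) =
      Submodule.inclusion (degreeFiltration_mono d.le_succ) (x.coeff i) -
        mulX N d (x.coeff (i + 1)) := by
  induction x using PolynomialModule.induction_linear with
  | zero => simp
  | add x y hx hy => simp only [map_add, coeff_add, Finsupp.add_apply, hx, hy]; abel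
  | single j v =>
    rw [charMap_single]
    simp only [PolynomialModule.coeff_sub, coeff_single, Finsupp.sub_apply, Finsupp.single_apply,
      add_left_inj]
    split_ifs <;> simp

theorem charMap_injective (d : ℕ) : Function.Injective (charMap N d) := by
  rw [injective_iff_map_eq_zero]
  intro x hx
  have step : ∀ i, x.coeff (i + 1) = 0 → x.coeff i = 0 := by
    intro i hi
    have := charMap_coeff_succ x i
    rw [hx, hi, map_zero, sub_zero, coeff_zero, Finsupp.zero_apply] at this
    exact Submodule.inclusion_injective _ (this.symm.trans (map_zero _).symm)
  obtain ⟨k, hk⟩ := exists_coeff_eq_zero x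
  have : ∀ k, (∀ i, k ≤ i → x.coeff i = 0) → ∀ i, x.coeff i = 0 := by
    intro k
    induction k with
    | zero => exact fun h i ↦ h i i.zero_le
    | succ k ih =>
      refine fun h ↦ ih fun i hi ↦ step i (h _ (by omega))
  exact coeff_eq_zero.1 (Finsupp.ext (this k hk))

theorem lift_subtype_mem {d : ℕ} (x : PolynomialModule A (degreeFiltration N d)) :
    lift (degreeFiltration N d).subtype x ∈ N := by
  obtain ⟨k, hk⟩ := exists_coeff_eq_zero x
  rw [lift_eq_sum _ _ hk]
  exact sum_mem fun i _ ↦ N.smul_mem _ (x.coeff i).2.1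

theorem lift_subtype_charMap {d : ℕ} (x : PolynomialModule A (degreeFiltration N d)) :
    lift (degreeFiltration N (d + 1)).subtype (charMap N d x) = 0 := by
  induction x using PolynomialModule.induction_linear with
  | zero => simp
  | add x y hx hy => rw [map_add, map_add, hx, hy, add_zero]
  | single j v =>
    rw [charMap_single, map_sub, lift_single, lift_single]
    simp [coe_mulX, pow_succ, mul_smul]

theorem mem_range_charMap {d : ℕ} (k : ℕ) :
    ∀ x : PolynomialModule A (degreeFiltration N (d + 1)), (∀ i, k ≤ i → x.coeff i = 0) →
      lift (degreeFiltration N (d + 1)).subtype x = 0 → x ∈ LinearMap.range (charMap N d) := by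
  induction k with
  | zero =>
    intro x hx _
    rw [coeff_eq_zero.1 (Finsupp.ext fun i ↦ hx i i.zero_le)]
    exact zero_mem _
  | succ k ih =>
    intro x hx h0
    rw [lift_eq_sum _ _ hx, Finset.sum_range_succ] at h0
    rcases k with _ | k
    · refine ih x (fun i _ ↦ ?_) ?_
      · rcases i with _ | i
        · simpa using h0
        · exact hx _ (by omega)
      · rw [lift_eq_sum _ _ hx]
        simpa using h0
    have hmem : (x.coeff (k + 1) : Fin n → A[X]) ∈ degreeFiltration N d := by
      refine mem_degreeFiltration.2 ⟨(mem_degreeFiltration.1 (x.coeff (k + 1)).2).1,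
        fun i j hj ↦ ?_⟩
      have h1 := congrArg (fun v : Fin n → A[X] ↦ (v i).coeff (j + (k + 1))) h0
      simp only [Submodule.subtype_apply, Pi.add_apply, Finset.sum_apply, Pi.smul_apply,
        smul_eq_mul, Polynomial.coeff_add, finsetSum_coeff, Polynomial.coeff_X_pow_mul,
        Pi.zero_apply, Polynomial.coeff_zero] at h1
      rwa [Finset.sum_eq_zero, zero_add] at h1
      intro l hl
      have hl' := Finset.mem_range.1 hl
      rw [Polynomial.coeff_X_pow_mul', if_pos (by omega)]
      exact (mem_degreeFiltration.1 (x.coeff l).2).2 _ _ (by omega)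
    let y := charMap N d (single A k ⟨x.coeff (k + 1), hmem⟩)
    have hy : y ∈ LinearMap.range (charMap N d) := LinearMap.mem_range_self _ _
    have : x - y ∈ LinearMap.range (charMap N d) := by
      refine ih _ (fun i hi ↦ ?_) ?_
      · simp only [y, charMap_single]
        simp only [PolynomialModule.coeff_sub, coeff_single, Finsupp.sub_apply,
          Finsupp.single_apply]
        rw [if_neg (show ¬ k = i by omega)]
        split_ifs with hki
        · subst hki
          ext1
          simp
        · rw [hx i (by omega)]
          simp
      · rw [map_sub, lift_subtype_charMap, sub_zero, lift_eq_sum _ _ hx, Finset.sum_range_succ,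
          h0]
    simpa using add_mem this hy

end Filtration

instance {A M : Type*} [CommRing A] [AddCommGroup M] [Module A M] [Module.Free A M] :
    Module.Free A[X] (PolynomialModule A M) :=
  .of_equiv (polynomialTensorProductLEquivPolynomialModule A M)

instance {A M : Type*} [CommRing A] [AddCommGroup M] [Module A M] [Module.Finite A M] :
    Module.Finite A[X] (PolynomialModule A M) :=
  .equiv (polynomialTensorProductLEquivPolynomialModule A M)

end PolynomialModule

open Polynomial PolynomialModule in
/-- Finitely generated projective modules over a polynomial ring in one variable over a principal
ideal domain are stably free. -/
theorem Module.IsStablyFree.of_projective_polynomial {A Q : Type*} [CommRing A] [IsDomain A]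
    [IsPrincipalIdealRing A] [AddCommGroup Q] [Module A[X] Q] [Module.Finite A[X] Q]
    [Module.Projective A[X] Q] : Module.IsStablyFree A[X] Q := by
  obtain ⟨n, f, g, -, hg, hfg⟩ := Module.Finite.exists_comp_eq_id_of_projective A[X] Q
  let N := LinearMap.range g
  let e : Q ≃ₗ[A[X]] N := LinearEquiv.ofInjective g hg
  have : Module.Finite A[X] N := .equiv e
  have : Module.Projective A[X] N := .of_equiv e
  obtain ⟨s, hs⟩ := Submodule.fg_def.1 (Module.Finite.iff_fg.1 ‹Module.Finite A[X] N›)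
  obtain ⟨d, hd⟩ : ∃ d, ∀ v ∈ s, v ∈ degreeFiltration N d := by
    have hsN : ∀ v ∈ s, ∃ d, v ∈ degreeFiltration N d := fun v hv ↦
      exists_mem_degreeFiltration (hs.2 ▸ Submodule.subset_span hv)
    choose! D hD using hsN
    obtain ⟨d, hd⟩ := (hs.1.image D).bddAbove
    exact ⟨d, fun v hv ↦ degreeFiltration_mono (hd ⟨v, hv, rfl⟩) (hD v hv)⟩
  let Φ : PolynomialModule A (degreeFiltration N (d + 1)) →ₗ[A[X]] N :=
    (lift (degreeFiltration N (d + 1)).subtype).codRestrict N lift_subtype_mem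
  have hΦ : Function.Surjective Φ := by
    have hle : N ≤ LinearMap.range (lift (degreeFiltration N (d + 1)).subtype) := by
      refine hs.2.symm.le.trans (Submodule.span_le.2 fun v hv ↦ ?_)
      refine ⟨single A 0 ⟨v, degreeFiltration_mono d.le_succ (hd v hv)⟩, ?_⟩
      simp [lift_single]
    rintro ⟨v, hv⟩
    obtain ⟨x, hx⟩ := hle hv
    exact ⟨x, Subtype.ext hx⟩
  have hexact : LinearMap.range (charMap N d) = LinearMap.ker Φ := by
    refine le_antisymm ?_ fun x hx ↦ ?_
    · rintro _ ⟨x, rfl⟩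
      exact LinearMap.mem_ker.2 (Subtype.ext (lift_subtype_charMap x))
    · obtain ⟨k, hk⟩ := exists_coeff_eq_zero x
      exact mem_range_charMap k x hk (congrArg Subtype.val (LinearMap.mem_ker.1 hx))
  obtain ⟨σ, hσ⟩ := Module.projective_lifting_property Φ .id hΦ
  have : Module.Free A[X] (PolynomialModule A (degreeFiltration N d) × N) :=
    .of_equiv (lequivProdOfRightSplitExact (charMap_injective d) hexact hσ).symm
  have : Module.IsStablyFree A[X] N :=
    .of_free_prod' _ _ (PolynomialModule A (degreeFiltration N d))
  exact .equiv e.symm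

section
variable {R P : Type*} [CommRing R] [AddCommGroup P] [Module R P]

/-- Base change to a quotient ring `S`, when free of finite rank, is given by a surjection from
`P` onto a power of `S` whose kernel is generated by the kernel of `R → S`. -/
theorem Module.Free.exists_surjective_of_baseChange {S : Type*} [CommRing S] [Algebra R S]
    (hS : Function.Surjective (algebraMap R S)) [Nontrivial S] [Module.Finite R P]
    [Module.Free S (TensorProduct R S P)] :
    ∃ (n : ℕ) (φ : P →ₗ[R] (Fin n → S)), Function.Surjective φ ∧
      LinearMap.ker φ = RingHom.ker (algebraMap R S) • (⊤ : Submodule R P) := by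
  obtain ⟨n, ⟨b⟩⟩ : ∃ n, Nonempty (TensorProduct R S P ≃ₗ[S] (Fin n → S)) :=
    ⟨_, ⟨(Module.finBasis S (TensorProduct R S P)).equivFun⟩⟩
  let I := RingHom.ker (algebraMap R S)
  let q : (R ⧸ I) ≃ₐ[R] S := Ideal.quotientKerAlgEquivOfSurjective (f := Algebra.ofId R S) hS
  let e : TensorProduct R (R ⧸ I) P ≃ₗ[R] (Fin n → S) :=
    (TensorProduct.congr q.toLinearEquiv (.refl R P)).trans (b.restrictScalars R)
  refine ⟨n, e.toLinearMap ∘ₗ TensorProduct.mk R (R ⧸ I) P 1, ?_, ?_⟩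
  · rw [LinearMap.coe_comp]
    refine e.surjective.comp ?_
    exact TensorProduct.mk_surjective _ _ _ Ideal.Quotient.mk_surjective
  · rw [LinearEquiv.ker_comp, LinearMap.ker_tensorProductMk]

variable {S k : Type*} [CommRing S] [CommRing k] [Algebra R S] [Algebra R k]

theorem LinearMap.compLeft_comp_surjective {ι : Type*} {φ : P →ₗ[R] (ι → S)} {π : S →ₐ[R] k}
    (hφ : Function.Surjective φ) (hk : Function.Surjective (algebraMap R k)) :
    Function.Surjective (π.toLinearMap.compLeft ι ∘ₗ φ) := fun v ↦ by
  choose r hr using fun i ↦ hk (v i)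
  obtain ⟨p, hp⟩ := hφ fun i ↦ algebraMap R S (r i)
  exact ⟨p, funext fun i ↦ by simp [hp, hr]⟩

/-- The kernel of the reduction of `φ` along `π` is generated by the kernel of `R → k`. -/
theorem LinearMap.ker_compLeft_comp {ι : Type*} [Finite ι] {J : Ideal R} {φ : P →ₗ[R] (ι → S)}
    {π : S →ₐ[R] k} (hφ : Function.Surjective φ) (hS : Function.Surjective (algebraMap R S))
    (hker : LinearMap.ker φ = RingHom.ker (algebraMap R S) • (⊤ : Submodule R P))
    (hk : RingHom.ker (algebraMap R k) = RingHom.ker (algebraMap R S) ⊔ J) :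
    LinearMap.ker (π.toLinearMap.compLeft ι ∘ₗ φ) =
      RingHom.ker (algebraMap R k) • (⊤ : Submodule R P) := by
  have := Fintype.ofFinite ι
  classical
  apply le_antisymm
  · intro p hp
    have hp' : ∀ i, ∃ j ∈ J, algebraMap R S j = φ p i := by
      intro i
      obtain ⟨r, hr⟩ := hS (φ p i)
      have hr0 : r ∈ RingHom.ker (algebraMap R k) := by
        rw [RingHom.mem_ker, ← π.commutes, hr]
        exact congrFun hp i
      rw [hk] at hr0
      obtain ⟨a, ha, j, hj, rfl⟩ := Submodule.mem_sup.1 hr0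
      refine ⟨j, hj, ?_⟩
      rw [← hr, map_add, RingHom.mem_ker.1 ha, zero_add]
    choose j hj hjp using hp'
    choose q hq using fun i : ι ↦ hφ (Pi.single i 1)
    have h1 : p - ∑ i, j i • q i ∈ LinearMap.ker φ := by
      rw [LinearMap.mem_ker, map_sub, sub_eq_zero, map_sum]
      funext i
      simp [hq, Finset.sum_apply, Pi.single_apply, Algebra.smul_def, hjp]
    rw [hk, Submodule.sup_smul, ← hker]
    rw [← sub_add_cancel p (∑ i, j i • q i)]
    exact Submodule.add_mem_sup h1
      (sum_mem fun i _ ↦ Submodule.smul_mem_smul (hj i) Submodule.mem_top)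
  · rw [Submodule.smul_le]
    intro r hr p _
    rw [LinearMap.mem_ker, map_smul]
    funext i
    simp [Algebra.smul_def, RingHom.mem_ker.1 hr]

variable {T : Type*} [CommRing T] [Algebra R T]

theorem LinearMap.range_sup_ker_eq_top {ι : Type*} {φ : P →ₗ[R] (ι → S)} {θ : (ι → R) →ₗ[R] P}
    (hS : Function.Surjective (algebraMap R S))
    (hθ : ∀ r i, φ (θ r) i = algebraMap R S (r i)) :
    LinearMap.range θ ⊔ LinearMap.ker φ = ⊤ := by
  refine eq_top_iff.2 fun x _ ↦ ?_
  choose r hr using fun i ↦ hS (φ x i)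
  rw [← add_sub_cancel (θ r) x]
  refine Submodule.add_mem_sup ⟨r, rfl⟩ ?_
  rw [LinearMap.mem_ker, map_sub, sub_eq_zero]
  funext i
  rw [hθ, hr]

/-- A module over a fibre product whose base changes to both factors have bases that agree over
the common quotient is free. -/
theorem Module.Free.of_compatible_surjections {ι : Type*} [Finite ι]
    {φ : P →ₗ[R] (ι → S)} {ψ : P →ₗ[R] (ι → T)} {π : S →ₐ[R] k} {ρ : T →ₐ[R] k}
    (hS : Function.Surjective (algebraMap R S))
    (hφ : Function.Surjective φ) (hψ : Function.Surjective ψ)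
    (hkφ : LinearMap.ker φ = RingHom.ker (algebraMap R S) • (⊤ : Submodule R P))
    (hkψ : LinearMap.ker ψ = RingHom.ker (algebraMap R T) • (⊤ : Submodule R P))
    (hT : Function.Surjective (algebraMap R T))
    (hinf : RingHom.ker (algebraMap R S) ⊓ RingHom.ker (algebraMap R T) = ⊥)
    (hk : RingHom.ker (algebraMap R k) =
      RingHom.ker (algebraMap R S) ⊔ RingHom.ker (algebraMap R T))
    (hcomp : π.toLinearMap.compLeft ι ∘ₗ φ = ρ.toLinearMap.compLeft ι ∘ₗ ψ) :
    Module.Free R P := by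
  have := Fintype.ofFinite ι
  classical
  have hlift : ∀ i, ∃ p, φ p = Pi.single i 1 ∧ ψ p = Pi.single i 1 := by
    intro i
    obtain ⟨p, hp⟩ := hφ (Pi.single i 1)
    obtain ⟨q, hq⟩ := hψ (Pi.single i 1)
    have hpq : p - q ∈ LinearMap.ker (π.toLinearMap.compLeft ι ∘ₗ φ) := by
      rw [LinearMap.mem_ker, map_sub, sub_eq_zero]
      conv_rhs => rw [hcomp]
      rw [LinearMap.comp_apply, LinearMap.comp_apply, hp, hq]
      funext j
      by_cases h : j = i
      · subst h; simp
      · simp [h]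
    rw [LinearMap.ker_compLeft_comp hφ hS hkφ hk, hk, Submodule.sup_smul, ← hkφ, ← hkψ] at hpq
    obtain ⟨u, hu, v, hv, huv⟩ := Submodule.mem_sup.1 hpq
    refine ⟨p - u, by rw [map_sub, LinearMap.mem_ker.1 hu, sub_zero, hp], ?_⟩
    have : p - u = q + v := by rw [eq_add_of_sub_eq huv.symm]; abel
    rw [this, map_add, LinearMap.mem_ker.1 hv, add_zero, hq]
  choose p hpφ hpψ using hlift
  let θ : (ι → R) →ₗ[R] P := Fintype.linearCombination R p
  have hθφ : ∀ r i, φ (θ r) i = algebraMap R S (r i) := fun r i ↦ by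
    simp [θ, Fintype.linearCombination_apply, hpφ, Pi.single_apply, Algebra.smul_def]
  have hθψ : ∀ r i, ψ (θ r) i = algebraMap R T (r i) := fun r i ↦ by
    simp [θ, Fintype.linearCombination_apply, hpψ, Pi.single_apply, Algebra.smul_def]
  have hinj : Function.Injective θ := by
    rw [injective_iff_map_eq_zero]
    intro r hr
    funext i
    have : r i ∈ RingHom.ker (algebraMap R S) ⊓ RingHom.ker (algebraMap R T) :=
      ⟨by rw [SetLike.mem_coe, RingHom.mem_ker, ← hθφ, hr, map_zero, Pi.zero_apply],
        by rw [SetLike.mem_coe, RingHom.mem_ker, ← hθψ, hr, map_zero, Pi.zero_apply]⟩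
    rwa [hinf] at this
  have hsurj : Function.Surjective θ := by
    rw [← LinearMap.range_eq_top, eq_top_iff]
    have hmul : RingHom.ker (algebraMap R S) * RingHom.ker (algebraMap R T) = ⊥ :=
      le_bot_iff.1 (hinf ▸ Ideal.mul_le_inf)
    have hsS := LinearMap.range_sup_ker_eq_top hS hθφ
    have hsT := LinearMap.range_sup_ker_eq_top hT hθψ
    rw [hkφ] at hsS
    rw [hkψ] at hsT
    refine hsS.ge.trans (sup_le le_rfl ?_)
    refine (Submodule.smul_mono le_rfl hsT.ge).trans ?_
    rw [Submodule.smul_sup, ← Submodule.mul_smul, hmul, Submodule.bot_smul, sup_bot_eq]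
    exact Submodule.smul_le_right
  exact .of_equiv (LinearEquiv.ofBijective θ ⟨hinj, hsurj⟩)

/-- Milnor patching of free modules: if `R` is the fibre product of `S` and `T` over `k`, where
all maps are surjective and `T → k` has a section, then a finitely generated `R`-module is free
as soon as its base changes to `S` and `T` are. -/
theorem Module.Free.of_milnor_square [Nontrivial S] [Nontrivial T] [Module.Finite R P]
    (π : S →ₐ[R] k) (ρ : T →ₐ[R] k) (σ : k →+* T) (hσ : ∀ a, ρ (σ a) = a)
    (hS : Function.Surjective (algebraMap R S)) (hT : Function.Surjective (algebraMap R T))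
    (hinf : RingHom.ker (algebraMap R S) ⊓ RingHom.ker (algebraMap R T) = ⊥)
    (hk : RingHom.ker (algebraMap R k) =
      RingHom.ker (algebraMap R S) ⊔ RingHom.ker (algebraMap R T))
    [Module.Free S (TensorProduct R S P)] [Module.Free T (TensorProduct R T P)] :
    Module.Free R P := by
  obtain ⟨m, φ, hφ, hkφ⟩ := exists_surjective_of_baseChange (P := P) hS
  obtain ⟨n, ψ, hψ, hkψ⟩ := exists_surjective_of_baseChange (P := P) hT
  have hRk : Function.Surjective (algebraMap R k) := fun a ↦ by
    obtain ⟨r, hr⟩ := hT (σ a)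
    exact ⟨r, by rw [← ρ.commutes, hr, hσ]⟩
  let φ₀ := π.toLinearMap.compLeft (Fin m) ∘ₗ φ
  let ψ₀ := ρ.toLinearMap.compLeft (Fin n) ∘ₗ ψ
  have hφ₀ : Function.Surjective φ₀ := LinearMap.compLeft_comp_surjective hφ hRk
  have hψ₀ : Function.Surjective ψ₀ := LinearMap.compLeft_comp_surjective hψ hRk
  have hker : LinearMap.ker ψ₀ = LinearMap.ker φ₀ := by
    rw [LinearMap.ker_compLeft_comp hφ hS hkφ hk,
      LinearMap.ker_compLeft_comp hψ hT hkψ (hk.trans (sup_comm _ _))]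
  let γ' : (Fin n → k) ≃ₗ[R] (Fin m → k) :=
    (ψ₀.quotKerEquivOfSurjective hψ₀).symm.trans
      ((Submodule.quotEquivOfEq _ _ hker).trans (φ₀.quotKerEquivOfSurjective hφ₀))
  have hγ' : ∀ p, γ' (ψ₀ p) = φ₀ p := fun p ↦ by
    have : (ψ₀.quotKerEquivOfSurjective hψ₀).symm (ψ₀ p) = Submodule.Quotient.mk p := by
      rw [LinearEquiv.symm_apply_eq]
      rfl
    simp only [γ', LinearEquiv.trans_apply, this]
    rfl
  let γ : (Fin n → k) ≃ₗ[k] (Fin m → k) := γ'.extendScalarsOfSurjective hRk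
  let M := LinearMap.toMatrix' γ.toLinearMap
  let M' := LinearMap.toMatrix' γ.symm.toLinearMap
  have hMM' : M * M' = 1 := by
    rw [← LinearMap.toMatrix'_comp, LinearEquiv.comp_symm, LinearMap.toMatrix'_id]
  have hM'M : M' * M = 1 := by
    rw [← LinearMap.toMatrix'_comp, LinearEquiv.symm_comp, LinearMap.toMatrix'_id]
  let Γ : (Fin n → T) ≃ₗ[T] (Fin m → T) :=
    Matrix.toLin'OfInv (M := M'.map σ) (M' := M.map σ)
      (by rw [← Matrix.map_mul, hM'M, Matrix.map_one _ (map_zero σ) (map_one σ)])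
      (by rw [← Matrix.map_mul, hMM', Matrix.map_one _ (map_zero σ) (map_one σ)])
  have hΓ : ∀ v i, ρ (Γ v i) = γ (fun j ↦ ρ (v j)) i := by
    intro v i
    have h1 : Γ v = (M.map σ).mulVec v := rfl
    have h2 : γ (fun j ↦ ρ (v j)) = M.mulVec fun j ↦ ρ (v j) := by
      rw [LinearMap.toMatrix'_mulVec]
      rfl
    rw [h1, h2]
    simp [Matrix.mulVec, dotProduct, hσ]
  refine of_compatible_surjections (φ := φ) (ψ := (Γ.restrictScalars R).toLinearMap ∘ₗ ψ)
    (π := π) (ρ := ρ) hS hφ ?_ hkφ ?_ hT hinf hk ?_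
  · rw [LinearMap.coe_comp]
    exact (Γ.restrictScalars R).surjective.comp hψ
  · rw [LinearEquiv.ker_comp, hkψ]
  · ext p i
    have : φ₀ p i = γ (ψ₀ p) i := (congrFun (hγ' p) i).symm
    exact this.trans (hΓ (ψ p) i).symm

end

theorem Module.IsStablyFree.eventually_free_prod (S Q : Type*) [CommRing S] [Nontrivial S]
    [AddCommGroup Q] [Module S Q] [Module.IsStablyFree S Q] :
    ∀ᶠ n in Filter.atTop, Module.Free S (Q × (Fin n → S)) := by
  obtain ⟨N, _, _, _, _, _⟩ := IsStablyFree.exist_free_prod S Q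
  refine Filter.eventually_atTop.2 ⟨Module.finrank S N, fun n hn ↦ ?_⟩
  obtain ⟨r, rfl⟩ := Nat.exists_eq_add_of_le hn
  let e : (N × (Fin r → S)) ≃ₗ[S] (Fin (Module.finrank S N + r) → S) :=
    .ofFinrankEq _ _ (by simp)
  exact .of_equiv
    ((LinearEquiv.prodAssoc S Q N (Fin r → S)).trans ((LinearEquiv.refl S Q).prodCongr e))

theorem Module.Free.baseChange_prod_pi {R S P : Type*} [CommRing R] [CommRing S] [Algebra R S]
    [AddCommGroup P] [Module R P] {n : ℕ}
    [Module.Free S (TensorProduct R S P × (Fin n → S))] :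
    Module.Free S (TensorProduct R S (P × (Fin n → R))) :=
  .of_equiv ((TensorProduct.prodRight R S S P (Fin n → R)).trans
    ((LinearEquiv.refl S _).prodCongr (TensorProduct.piScalarRight R S S (Fin n)))).symm

universe u v w in
/-- If `R` is the fibre product of `S` and `T` over `k`, where all maps are surjective and `T → k`
has a section, then finitely generated projective `R`-modules are stably free as soon as this holds
for `S` and `T`. -/
theorem Module.IsStablyFree.exists_free_prod_of_milnor_square {R k : Type*} {S : Type u}
    {T : Type v} {P : Type w} [CommRing R] [CommRing S] [CommRing T] [CommRing k] [Nontrivial S]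
    [Nontrivial T] [AddCommGroup P] [Module R P] [Module.Finite R P] [Module.Projective R P]
    (f : R →+* S) (g : R →+* T) (π : S →+* k) (ρ : T →+* k) (σ : k →+* T)
    (hσ : ∀ a, ρ (σ a) = a) (hf : Function.Surjective f) (hg : Function.Surjective g)
    (hfg : π.comp f = ρ.comp g) (hinf : RingHom.ker f ⊓ RingHom.ker g = ⊥)
    (hker : RingHom.ker (π.comp f) = RingHom.ker f ⊔ RingHom.ker g)
    (hS : ∀ (Q : Type (max u w)) [AddCommGroup Q] [Module S Q] [Module.Finite S Q]
      [Module.Projective S Q], Module.IsStablyFree S Q)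
    (hT : ∀ (Q : Type (max v w)) [AddCommGroup Q] [Module T Q] [Module.Finite T Q]
      [Module.Projective T Q], Module.IsStablyFree T Q) :
    ∃ n, Module.Free R (P × (Fin n → R)) := by
  let _ : Algebra R S := f.toAlgebra
  let _ : Algebra R T := g.toAlgebra
  let _ : Algebra R k := (π.comp f).toAlgebra
  let π' : S →ₐ[R] k := { π with commutes' := fun _ ↦ rfl }
  let ρ' : T →ₐ[R] k := { ρ with commutes' := fun r ↦ (RingHom.congr_fun hfg r).symm }
  have := hS (TensorProduct R S P)
  have := hT (TensorProduct R T P)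
  obtain ⟨n, hnS, hnT⟩ := ((eventually_free_prod S (TensorProduct R S P)).and
    (eventually_free_prod T (TensorProduct R T P))).exists
  have : Module.Free S (TensorProduct R S (P × (Fin n → R))) := .baseChange_prod_pi
  have : Module.Free T (TensorProduct R T (P × (Fin n → R))) := .baseChange_prod_pi
  exact ⟨n, .of_milnor_square π' ρ' σ hσ hf hg hinf hker⟩
namespace NodeRing

/-- Restriction of functions on the node to its branch `Y = 0`. -/
noncomputable def toBranchX : NodeRing →+* Polynomial ℤ :=
  Ideal.Quotient.lift _ (aeval ![Polynomial.X, 0] : MvPolynomial (Fin 2) ℤ →ₐ[ℤ] _).toRingHom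
    fun p hp ↦ by
      obtain ⟨q, rfl⟩ := Ideal.mem_span_singleton'.1 hp
      simp

/-- Restriction of functions on the node to its branch `X = 0`. -/
noncomputable def toBranchY : NodeRing →+* Polynomial ℤ :=
  Ideal.Quotient.lift _ (aeval ![0, Polynomial.X] : MvPolynomial (Fin 2) ℤ →ₐ[ℤ] _).toRingHom
    fun p hp ↦ by
      obtain ⟨q, rfl⟩ := Ideal.mem_span_singleton'.1 hp
      simp

theorem toBranchX_mk (p : MvPolynomial (Fin 2) ℤ) :
    toBranchX (Ideal.Quotient.mk _ p) = aeval ![Polynomial.X, 0] p := rfl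

theorem toBranchY_mk (p : MvPolynomial (Fin 2) ℤ) :
    toBranchY (Ideal.Quotient.mk _ p) = aeval ![0, Polynomial.X] p := rfl

/-- The inclusion of `ℤ[t]` in the coordinate ring of the node sending `t` to the `i`-th
coordinate. -/
noncomputable def ofPolynomial (i : Fin 2) : Polynomial ℤ →+* NodeRing :=
  (Polynomial.aeval (Ideal.Quotient.mk _ (X i) : NodeRing)).toRingHom

theorem ofPolynomial_X (i : Fin 2) :
    ofPolynomial i Polynomial.X = Ideal.Quotient.mk _ (X i) := by
  simp [ofPolynomial]

theorem toBranchX_ofPolynomial (q : Polynomial ℤ) : toBranchX (ofPolynomial 0 q) = q := by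
  have : toBranchX.comp (ofPolynomial 0) = RingHom.id _ :=
    Polynomial.ringHom_ext (by simp) (by simp [ofPolynomial_X, toBranchX_mk])
  exact RingHom.congr_fun this q

theorem toBranchY_ofPolynomial (q : Polynomial ℤ) : toBranchY (ofPolynomial 1 q) = q := by
  have : toBranchY.comp (ofPolynomial 1) = RingHom.id _ :=
    Polynomial.ringHom_ext (by simp) (by simp [ofPolynomial_X, toBranchY_mk])
  exact RingHom.congr_fun this q

theorem toBranchY_ofPolynomial_zero (q : Polynomial ℤ) :
    toBranchY (ofPolynomial 0 q) = Polynomial.C (Polynomial.evalRingHom 0 q) := by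
  have : toBranchY.comp (ofPolynomial 0) = Polynomial.C.comp (Polynomial.evalRingHom 0) :=
    Polynomial.ringHom_ext (by simp) (by simp [ofPolynomial_X, toBranchY_mk])
  exact RingHom.congr_fun this q

theorem evalRingHom_comp_toBranchX : (Polynomial.evalRingHom 0).comp toBranchX =
    (Polynomial.evalRingHom 0).comp toBranchY := by
  refine Ideal.Quotient.ringHom_ext (MvPolynomial.ringHom_ext (by simp) fun i ↦ ?_)
  fin_cases i <;> simp [toBranchX_mk, toBranchY_mk]

theorem X_one_dvd_of_aeval_eq_zero {p : MvPolynomial (Fin 2) ℤ}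
    (h : aeval ![(Polynomial.X : Polynomial ℤ), 0] p = 0) : X 1 ∣ p := by
  have key : (Ideal.Quotient.mk (Ideal.span {X 1})) =
      ((Ideal.Quotient.mk (Ideal.span {(X 1 : MvPolynomial (Fin 2) ℤ)})).comp
        (Polynomial.aeval (X 0 : MvPolynomial (Fin 2) ℤ)).toRingHom).comp
        (aeval ![(Polynomial.X : Polynomial ℤ), 0]).toRingHom := by
    refine MvPolynomial.ringHom_ext (by simp) fun i ↦ ?_
    fin_cases i <;> simp
  rw [← Ideal.mem_span_singleton, ← Ideal.Quotient.eq_zero_iff_mem, key]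
  simp [h]

theorem X_zero_dvd_of_aeval_eq_zero {p : MvPolynomial (Fin 2) ℤ}
    (h : aeval ![0, (Polynomial.X : Polynomial ℤ)] p = 0) : X 0 ∣ p := by
  have key : (Ideal.Quotient.mk (Ideal.span {X 0})) =
      ((Ideal.Quotient.mk (Ideal.span {(X 0 : MvPolynomial (Fin 2) ℤ)})).comp
        (Polynomial.aeval (X 1 : MvPolynomial (Fin 2) ℤ)).toRingHom).comp
        (aeval ![0, (Polynomial.X : Polynomial ℤ)]).toRingHom := by
    refine MvPolynomial.ringHom_ext (by simp) fun i ↦ ?_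
    fin_cases i <;> simp
  rw [← Ideal.mem_span_singleton, ← Ideal.Quotient.eq_zero_iff_mem, key]
  simp [h]

theorem ker_inf_ker : RingHom.ker toBranchX ⊓ RingHom.ker toBranchY = ⊥ := by
  refine eq_bot_iff.2 fun r hr ↦ ?_
  obtain ⟨hx, hy⟩ := Submodule.mem_inf.1 hr
  obtain ⟨p, rfl⟩ := Ideal.Quotient.mk_surjective r
  rw [RingHom.mem_ker, toBranchX_mk] at hx
  rw [RingHom.mem_ker, toBranchY_mk] at hy
  obtain ⟨q, rfl⟩ := X_one_dvd_of_aeval_eq_zero hx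
  obtain ⟨q, rfl⟩ := X_zero_dvd_of_aeval_eq_zero (p := q) (by simpa using hy)
  rw [Submodule.mem_bot, Ideal.Quotient.eq_zero_iff_mem, Ideal.mem_span_singleton]
  exact ⟨q, by ring⟩

theorem ker_evalRingHom_comp_toBranchX :
    RingHom.ker ((Polynomial.evalRingHom 0).comp toBranchX) =
      RingHom.ker toBranchX ⊔ RingHom.ker toBranchY := by
  refine le_antisymm (fun r hr ↦ ?_) (sup_le (fun r hr ↦ ?_) fun r hr ↦ ?_)
  · rw [← sub_add_cancel r (ofPolynomial 0 (toBranchX r))]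
    refine Submodule.add_mem_sup ?_ ?_
    · rw [RingHom.mem_ker, map_sub, toBranchX_ofPolynomial, sub_self]
    · rw [RingHom.mem_ker, RingHom.comp_apply] at hr
      rw [RingHom.mem_ker, toBranchY_ofPolynomial_zero, hr, map_zero]
  · rw [RingHom.mem_ker, RingHom.comp_apply, RingHom.mem_ker.1 hr, map_zero]
  · rw [evalRingHom_comp_toBranchX, RingHom.mem_ker, RingHom.comp_apply, RingHom.mem_ker.1 hr,
      map_zero]

end NodeRing

/-- Every finitely generated projective module over `R = ℤ[X,Y]/(XY)` is stably free:
`P ⊕ Rⁿ ≅ Rᵐ` for some natural numbers `n, m`. -/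
theorem statement_17 (P : Type*) [AddCommGroup P] [Module NodeRing P]
    [Module.Finite NodeRing P] [Module.Projective NodeRing P] :
    ∃ n m : ℕ, Nonempty ((P × (Fin n → NodeRing)) ≃ₗ[NodeRing] (Fin m → NodeRing)) := by
  obtain ⟨n, hn⟩ := Module.IsStablyFree.exists_free_prod_of_milnor_square (P := P)
    NodeRing.toBranchX NodeRing.toBranchY (Polynomial.evalRingHom 0) (Polynomial.evalRingHom 0)
    Polynomial.C (fun _ ↦ Polynomial.eval_C)
    (fun q ↦ ⟨_, NodeRing.toBranchX_ofPolynomial q⟩)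
    (fun q ↦ ⟨_, NodeRing.toBranchY_ofPolynomial q⟩)
    NodeRing.evalRingHom_comp_toBranchX NodeRing.ker_inf_ker
    NodeRing.ker_evalRingHom_comp_toBranchX
    (fun Q _ _ _ _ ↦ .of_projective_polynomial) (fun Q _ _ _ _ ↦ .of_projective_polynomial)
  have : Nontrivial NodeRing := NodeRing.toBranchX.domain_nontrivial
  exact ⟨n, _, ⟨(Module.finBasis NodeRing (P × (Fin n → NodeRing))).equivFun⟩⟩
end
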